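/- arXiv:2405.20002 — 4 statements merged into one kernel-verified Lean document; each statement's English description precedes it below -/
import Mathlib

section
/- For all integers k ≥ 8 and l ≥ 2, the maximum over all (k,l)-intersection matrices N of |K_N| · ∏_{i,j} N_{i,j}! equals k! · (l!)^k; that is, μ(k,l) = k!·(l!)^k. -/
/-- A `(k,l)`-intersection matrix: a `k × k` matrix of nonnegative integers all of whose
row sums and column sums equal `l`. -/
def IsInterMatrix (k l : ℕ) (N : Fin k → Fin k → ℕ) : Prop :=
  (∀ i, ∑ j, N i j = l) ∧ ∀ j, ∑ i, N i j = l

/-- `|K_N|`: the order of the stabilizer of `N` under the action of `S_k × S_k`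
simultaneously permuting rows and columns. -/
noncomputable def stabCard {k : ℕ} (N : Fin k → Fin k → ℕ) : ℕ :=
  Nat.card {p : Equiv.Perm (Fin k) × Equiv.Perm (Fin k) // ∀ i j, N (p.1 i) (p.2 j) = N i j}

/-- `|K_N| · ∏_{i,j} N_{i,j}!`, the order of the automorphism group of the `(k,l)`-bipartite
graph with bipartite adjacency matrix `N`. -/
noncomputable def autCard {k : ℕ} (N : Fin k → Fin k → ℕ) : ℕ :=
  stabCard N * ∏ i, ∏ j, (N i j).factorial

/-- An automorphism of the multigraph is determined by its action on the rows and, for each row,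
by the induced bijection between the edges at that row and the edges at its image. -/
theorem autCard_le {k l : ℕ} (hl : l ≠ 0) {N : Fin k → Fin k → ℕ} (hN : IsInterMatrix k l N) :
    autCard N ≤ k.factorial * l.factorial ^ k := by
  classical
  let E (i : Fin k) : Type := Σ j, Fin (N i j)
  have hE (i) : Fintype.card (E i) = l := by simp [E, hN.1 i]
  let K := {p : Equiv.Perm (Fin k) × Equiv.Perm (Fin k) // ∀ i j, N (p.1 i) (p.2 j) = N i j}
  let f : (K × ∀ i j, Equiv.Perm (Fin (N i j))) →
      Σ σ : Equiv.Perm (Fin k), ∀ i, E i ≃ E (σ i) := fun q =>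
    ⟨q.1.1.1, fun i => Equiv.sigmaCongr q.1.1.2
      fun j => (q.2 i j).trans (finCongr (q.1.2 i j).symm)⟩
  have hf : Function.Injective f := by
    rintro ⟨⟨⟨σ, τ⟩, h⟩, π⟩ ⟨⟨⟨σ', τ'⟩, h'⟩, π'⟩ hq
    obtain ⟨hσ, hq⟩ := Sigma.mk.inj hq
    dsimp only at hσ
    subst hσ
    have hq := eq_of_heq hq
    have key (i j) (x : Fin (N i j)) := Equiv.congr_fun (congrFun hq i) ⟨j, x⟩
    have hτ : τ = τ' := by
      ext1 j
      obtain ⟨i, -, hi⟩ := Finset.exists_ne_zero_of_sum_ne_zero ((hN.2 j).trans_ne hl)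
      exact congrArg Sigma.fst (key i j ⟨0, Nat.pos_of_ne_zero hi⟩)
    subst hτ
    have hπ : π = π' := by
      ext i j x
      simpa [Equiv.sigmaCongr, Fin.ext_iff] using key i j x
    rw [hπ]
  have hcard (σ : Equiv.Perm (Fin k)) (i) : Fintype.card (E i ≃ E (σ i)) = l.factorial := by
    rw [Fintype.card_equiv (Fintype.equivOfCardEq ((hE i).trans (hE (σ i)).symm)), hE]
  have hle := Fintype.card_le_of_injective f hf
  simpa [autCard, stabCard, K, Fintype.card_sigma, Fintype.card_pi, Fintype.card_perm, hcard]
    using hle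

/-- The scalar matrix `l • 1` is fixed exactly by the pairs `(σ, σ)`. -/
theorem autCard_scalar (k : ℕ) {l : ℕ} (hl : l ≠ 0) :
    autCard (fun i j : Fin k => if i = j then l else 0) = k.factorial * l.factorial ^ k := by
  have hstab : stabCard (fun i j : Fin k => if i = j then l else 0) = k.factorial := by
    let e : {p : Equiv.Perm (Fin k) × Equiv.Perm (Fin k) //
        ∀ i j, (if p.1 i = p.2 j then l else 0) = if i = j then l else 0} ≃
        Equiv.Perm (Fin k) :=
      { toFun := fun p => p.1.1
        invFun := fun σ => ⟨(σ, σ), by simp⟩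
        left_inv := by
          rintro ⟨⟨σ, τ⟩, h⟩
          have hστ : σ = τ := by
            ext1 i
            by_contra hne
            exact hl (by simpa [hne] using (h i i).symm)
          simp [hστ]
        right_inv := fun _ => rfl }
    rw [stabCard, Nat.card_congr e, Nat.card_perm, Nat.card_fin]
  simp [autCard, hstab, apply_ite Nat.factorial]

/-- μ(k,l) = k!·(l!)^k for k ≥ 8 and l ≥ 2. -/
theorem mu_eq (k l : ℕ) (hk : 8 ≤ k) (hl : 2 ≤ l) :
    IsGreatest {m | ∃ N : Fin k → Fin k → ℕ, IsInterMatrix k l N ∧ m = autCard N}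
      (k.factorial * l.factorial ^ k) := by
  have hl : l ≠ 0 := by omega
  refine ⟨⟨_, ⟨by simp, by simp⟩, (autCard_scalar k hl).symm⟩, ?_⟩
  rintro _ ⟨N, hN, rfl⟩
  exact autCard_le hl hN
end

section
/- For every integer k ≥ 3, the minimum over all (k,2)-intersection matrices N of |K_N| · ∏_{i,j} N_{i,j}! equals 2k; that is, χ(k,2) = 2k. -/
open Equiv in
/-- A matrix with constant positive line sums dominates a permutation matrix, and the difference
again has constant line sums. -/
theorem IsInterMatrix.exists_perm_add {k l : ℕ} {N : Fin k → Fin k → ℕ}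
    (h : IsInterMatrix k (l + 1) N) :
    ∃ (a : Perm (Fin k)) (M : Fin k → Fin k → ℕ), IsInterMatrix k l M ∧
      ∀ i j, N i j = (if a i = j then 1 else 0) + M i j := by
  obtain ⟨a, ha⟩ : ∃ a : Perm (Fin k), ∀ i, 0 < N i (a i) := by
    have hl : (0 : ℚ) < l + 1 := by positivity
    have hM : Matrix.of (fun i j => (N i j : ℚ) / (l + 1)) ∈ doublyStochastic ℚ (Fin k) := by
      rw [mem_doublyStochastic_iff_sum]
      refine ⟨fun i j => by simp only [Matrix.of_apply]; positivity, fun i => ?_, fun j => ?_⟩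
      · simp only [Matrix.of_apply, ← Finset.sum_div]
        rw [div_eq_one_iff_eq hl.ne']
        exact_mod_cast h.1 i
      · simp only [Matrix.of_apply, ← Finset.sum_div]
        rw [div_eq_one_iff_eq hl.ne']
        exact_mod_cast h.2 j
    obtain ⟨w, hw0, hw1, hw⟩ := exists_eq_sum_perm_of_mem_doublyStochastic hM
    obtain ⟨a, -, ha⟩ : ∃ a ∈ Finset.univ, w a ≠ 0 :=
      Finset.exists_ne_zero_of_sum_ne_zero (by rw [hw1]; exact one_ne_zero)
    refine ⟨a, fun i => Nat.pos_of_ne_zero fun h0 => ha ?_⟩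
    have hi := congrFun (congrFun hw i) (a i)
    simp only [Matrix.sum_apply, Matrix.smul_apply, Matrix.of_apply, h0, Nat.cast_zero, zero_div,
      smul_eq_mul] at hi
    rw [Finset.sum_eq_zero_iff_of_nonneg] at hi
    · simpa [Equiv.Perm.permMatrix, PEquiv.toMatrix_apply] using hi a (Finset.mem_univ a)
    · intro b _
      refine mul_nonneg (hw0 b) ?_
      simp only [Equiv.Perm.permMatrix, PEquiv.toMatrix_apply]
      split_ifs <;> norm_num
  have key : ∀ i j, N i j = (if a i = j then 1 else 0) + (N i j - if a i = j then 1 else 0) := by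
    intro i j
    split_ifs with hij
    · have := ha i
      rw [hij] at this
      omega
    · omega
  refine ⟨a, fun i j => N i j - if a i = j then 1 else 0, ⟨fun i => ?_, fun j => ?_⟩, key⟩
  · have h1 := h.1 i
    rw [Finset.sum_congr rfl fun j _ => key i j, Finset.sum_add_distrib] at h1
    simp only [Finset.sum_ite_eq, Finset.mem_univ, if_true] at h1
    exact Nat.add_left_cancel (h1.trans (add_comm l 1))
  · have h1 := h.2 j
    rw [Finset.sum_congr rfl fun i _ => key i j, Finset.sum_add_distrib] at h1
    simp only [← Equiv.eq_symm_apply, Finset.sum_ite_eq', Finset.mem_univ, if_true] at h1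
    simp only [← Equiv.eq_symm_apply]
    omega

open Equiv in
/-- A `(k,2)`-intersection matrix is a sum of two permutation matrices. -/
theorem IsInterMatrix.exists_eq_add {k : ℕ} {N : Fin k → Fin k → ℕ} (h : IsInterMatrix k 2 N) :
    ∃ a b : Perm (Fin k), ∀ i j,
      N i j = (if a i = j then 1 else 0) + (if b i = j then 1 else 0) := by
  obtain ⟨a, M, hM, ha⟩ := h.exists_perm_add
  obtain ⟨b, L, hL, hb⟩ := hM.exists_perm_add
  refine ⟨a, b, fun i j => ?_⟩
  have : L i j = 0 := (Finset.sum_eq_zero_iff.1 (hL.1 i)) j (Finset.mem_univ j)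
  rw [ha, hb, this, add_zero]

theorem Multiset.sum_le_prod_of_two_le {s : Multiset ℕ} (hs : ∀ n ∈ s, 2 ≤ n) :
    s.sum ≤ s.prod := by
  induction s using Multiset.induction_on with
  | empty => simp
  | cons a s ih =>
    have ha := hs a (mem_cons_self a s)
    have ih := ih fun n hn => hs n (mem_cons_of_mem hn)
    rw [sum_cons, prod_cons]
    rcases s.empty_or_exists_mem with rfl | ⟨b, hb⟩
    · simp
    · have hb2 : 2 ≤ s.sum := (hs b (mem_cons_of_mem hb)).trans (le_sum_of_mem hb)
      nlinarith

namespace Equiv.Perm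

variable {α : Type*} [Fintype α] [DecidableEq α]

theorem card_le_card_centralizer_mul {g : Perm α} (hg : g ≠ 1) :
    Fintype.card α ≤ Nat.card (Subgroup.centralizer {g}) *
      2 ^ (Fintype.card α - g.cycleType.sum) := by
  have hle := g.sum_cycleType_le
  have hsum : 1 ≤ g.cycleType.sum := by
    rw [sum_cycleType]
    exact Finset.card_pos.2 (Finset.nonempty_iff_ne_empty.2 (by simpa using hg))
  have hsp := Multiset.sum_le_prod_of_two_le fun n hn => two_le_of_mem_cycleType (σ := g) hn
  have hcent : g.cycleType.sum ≤ Nat.card (Subgroup.centralizer {g}) := by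
    rw [nat_card_centralizer]
    have h1 := Nat.factorial_pos (Fintype.card α - g.cycleType.sum)
    have h2 : 0 < ∏ n ∈ g.cycleType.toFinset, (g.cycleType.count n).factorial :=
      Finset.prod_pos fun n _ => Nat.factorial_pos _
    exact hsp.trans ((Nat.le_mul_of_pos_left _ h1).trans (Nat.le_mul_of_pos_right _ h2))
  have hpow := Nat.lt_two_pow_self (n := Fintype.card α - g.cycleType.sum)
  obtain ⟨f, hf⟩ := Nat.exists_eq_add_of_le hle
  rw [hf, Nat.add_sub_cancel_left] at hpow ⊢
  nlinarith

end Equiv.Perm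

open Equiv in
theorem two_pow_card_sub_le_prod_factorial {k : ℕ} {N : Fin k → Fin k → ℕ} {a b : Perm (Fin k)}
    (h : ∀ i j, N i j = (if a i = j then 1 else 0) + (if b i = j then 1 else 0)) :
    2 ^ (k - (a⁻¹ * b).cycleType.sum) ≤ ∏ i, ∏ j, (N i j).factorial := by
  have hfix : k - (a⁻¹ * b).cycleType.sum = (Finset.univ.filter fun i => a i = b i).card := by
    have hc : (Finset.univ.filter fun i => a i = b i) = (a⁻¹ * b).supportᶜ := by
      ext i
      simp [Equiv.symm_apply_eq, eq_comm (a := a i)]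
    rw [hc, Finset.card_compl, Fintype.card_fin, Perm.sum_cycleType]
  rw [hfix, ← Finset.prod_const, Finset.prod_filter]
  refine Finset.prod_le_prod' fun i _ => ?_
  split_ifs with hi
  · calc 2 = (N i (a i)).factorial := by simp [h, hi]
      _ ≤ _ := Finset.single_le_prod' (f := fun j => (N i j).factorial)
        (fun j _ => Nat.factorial_pos _) (Finset.mem_univ _)
  · exact Finset.one_le_prod' fun j _ => Nat.factorial_pos _

section Stabilizer

open Equiv

variable {k : ℕ} {N : Fin k → Fin k → ℕ} {a b : Perm (Fin k)}

theorem stab_of_commute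
    (h : ∀ i j, N i j = (if a i = j then 1 else 0) + (if b i = j then 1 else 0))
    {p : Perm (Fin k)} (hp : p * (a⁻¹ * b) = a⁻¹ * b * p) (i j : Fin k) :
    N (p i) ((a * p * a⁻¹) j) = N i j := by
  have hb : b (p i) = a (p (a⁻¹ (b i))) := by
    have := congrArg a (congrArg (fun g : Perm (Fin k) => g i) hp)
    simpa using this.symm
  simp [h, hb, Equiv.eq_symm_apply]

theorem stab_of_semiconj
    (h : ∀ i j, N i j = (if a i = j then 1 else 0) + (if b i = j then 1 else 0))
    {p : Perm (Fin k)} (hp : a⁻¹ * b * p * (a⁻¹ * b) = p) (i j : Fin k) :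
    N (p i) ((b * p * a⁻¹) j) = N i j := by
  have ha : a (p i) = b (p (a⁻¹ (b i))) := by
    have := congrArg a (congrArg (fun g : Perm (Fin k) => g i) hp)
    simpa using this.symm
  rw [h, h, add_comm]
  simp [ha, Equiv.eq_symm_apply]

theorem card_centralizer_le_stabCard
    (h : ∀ i j, N i j = (if a i = j then 1 else 0) + (if b i = j then 1 else 0)) :
    Nat.card (Subgroup.centralizer {a⁻¹ * b}) ≤ stabCard N := by
  refine Nat.card_le_card_of_injective (fun p => ⟨(p.1, a * p.1 * a⁻¹), stab_of_commute h
    (Subgroup.mem_centralizer_singleton_iff.1 p.2)⟩) ?_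
  intro p q hpq
  exact Subtype.ext (congrArg (fun x => x.1.1) hpq)

theorem two_mul_card_centralizer_le_stabCard
    (h : ∀ i j, N i j = (if a i = j then 1 else 0) + (if b i = j then 1 else 0))
    (hab : a⁻¹ * b ≠ 1) :
    2 * Nat.card (Subgroup.centralizer {a⁻¹ * b}) ≤ stabCard N := by
  obtain ⟨c, hc⟩ := isConj_iff.1 (Perm.isConj_iff_cycleType_eq.2 (a⁻¹ * b).cycleType_inv.symm)
  have hcp : ∀ p : Subgroup.centralizer {a⁻¹ * b},
      a⁻¹ * b * (c * p.1) * (a⁻¹ * b) = c * p.1 := by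
    intro p
    have hp := Subgroup.mem_centralizer_singleton_iff.1 p.2
    have hc' : a⁻¹ * b * c * (a⁻¹ * b) = c := by
      rw [mul_inv_eq_iff_eq_mul] at hc
      rw [mul_assoc, hc, mul_inv_cancel_left]
    calc a⁻¹ * b * (c * p.1) * (a⁻¹ * b) = a⁻¹ * b * c * (p.1 * (a⁻¹ * b)) := by group
      _ = a⁻¹ * b * c * (a⁻¹ * b) * p.1 := by rw [hp]; group
      _ = c * p.1 := by rw [hc']
  rw [two_mul, ← Nat.card_sum]
  refine Nat.card_le_card_of_injective (Sum.elim
    (fun p => ⟨(p.1, a * p.1 * a⁻¹), stab_of_commute h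
      (Subgroup.mem_centralizer_singleton_iff.1 p.2)⟩)
    (fun p => ⟨(c * p.1, b * (c * p.1) * a⁻¹), stab_of_semiconj h (hcp p)⟩)) ?_
  refine Function.Injective.sumElim ?_ ?_ ?_
  · intro p q hpq
    exact Subtype.ext (congrArg (fun x => x.1.1) hpq)
  · intro p q hpq
    exact Subtype.ext (mul_left_cancel (congrArg (fun x => x.1.1) hpq))
  · intro p q hpq
    have h1 : p.1 = c * q.1 := congrArg (fun x => x.1.1) hpq
    have h2 : a * p.1 * a⁻¹ = b * (c * q.1) * a⁻¹ := congrArg (fun x => x.1.2) hpq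
    rw [h1] at h2
    exact hab (inv_mul_eq_one.2 (mul_right_cancel (mul_right_cancel h2)))

end Stabilizer

theorem IsInterMatrix.two_mul_le_autCard {k : ℕ} (hk : 3 ≤ k) {N : Fin k → Fin k → ℕ}
    (hN : IsInterMatrix k 2 N) : 2 * k ≤ autCard N := by
  obtain ⟨a, b, h⟩ := hN.exists_eq_add
  have hprod := two_pow_card_sub_le_prod_factorial h
  unfold autCard
  by_cases hab : a⁻¹ * b = 1
  · have hstab := card_centralizer_le_stabCard h
    have hcent : k ≤ Nat.card (Subgroup.centralizer {a⁻¹ * b}) := by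
      rw [Equiv.Perm.nat_card_centralizer, hab]
      simpa using Nat.self_le_factorial k
    rw [hab] at hprod
    simp only [Equiv.Perm.cycleType_one, Multiset.sum_zero, Nat.sub_zero] at hprod
    have h2 : 2 ≤ 2 ^ k := Nat.le_self_pow (by omega) 2
    rw [mul_comm 2]
    exact Nat.mul_le_mul (hcent.trans hstab) (h2.trans hprod)
  · have hstab := two_mul_card_centralizer_le_stabCard h hab
    have hcard := Equiv.Perm.card_le_card_centralizer_mul hab
    rw [Fintype.card_fin] at hcard
    calc 2 * k ≤ 2 * Nat.card (Subgroup.centralizer {a⁻¹ * b}) *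
          2 ^ (k - (a⁻¹ * b).cycleType.sum) := by rw [mul_assoc]; omega
      _ ≤ _ := Nat.mul_le_mul hstab hprod

/-- The bipartite adjacency matrix of the cycle of length `2 * (n + 1)`. -/
def cycleMatrix (n : ℕ) (i j : Fin (n + 1)) : ℕ :=
  (if i = j then 1 else 0) + (if i + 1 = j then 1 else 0)

theorem isInterMatrix_cycleMatrix (n : ℕ) : IsInterMatrix (n + 1) 2 (cycleMatrix n) := by
  refine ⟨fun i => ?_, fun j => ?_⟩
  · simp [cycleMatrix, Finset.sum_add_distrib]
  · simp [cycleMatrix, Finset.sum_add_distrib, ← eq_sub_iff_add_eq]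

theorem Fin.add_one_ne_self {n : ℕ} (hn : 1 ≤ n) (i : Fin (n + 1)) : i + 1 ≠ i := by
  obtain ⟨m, rfl⟩ := Nat.exists_eq_add_of_le' hn
  simp

theorem prod_factorial_cycleMatrix {n : ℕ} (hn : 1 ≤ n) :
    ∏ i, ∏ j, (cycleMatrix n i j).factorial = 1 := by
  refine Finset.prod_eq_one fun i _ => Finset.prod_eq_one fun j _ => ?_
  have := Fin.add_one_ne_self hn i
  unfold cycleMatrix
  split_ifs with h1 h2
  · exact absurd (h2.trans h1.symm) this
  all_goals rfl

theorem cycleMatrix_ne_zero_iff {n : ℕ} {i j : Fin (n + 1)} :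
    cycleMatrix n i j ≠ 0 ↔ i = j ∨ i + 1 = j := by
  unfold cycleMatrix
  split_ifs <;> simp_all

theorem eq_of_stab_cycleMatrix {n : ℕ} (hn : 1 ≤ n) {p q p' q' : Equiv.Perm (Fin (n + 1))}
    (h : ∀ i j, cycleMatrix n (p i) (q j) = cycleMatrix n i j)
    (h' : ∀ i j, cycleMatrix n (p' i) (q' j) = cycleMatrix n i j)
    (hp : p 0 = p' 0) (hq : q 0 = q' 0) : p = p' ∧ q = q' := by
  have adj : ∀ {p q : Equiv.Perm (Fin (n + 1))},
      (∀ i j, cycleMatrix n (p i) (q j) = cycleMatrix n i j) →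
      ∀ i, (p i = q i ∨ p i + 1 = q i) ∧ (p i = q (i + 1) ∨ p i + 1 = q (i + 1)) := by
    intro p q h i
    constructor
    · rw [← cycleMatrix_ne_zero_iff, h, cycleMatrix_ne_zero_iff]
      exact Or.inl rfl
    · rw [← cycleMatrix_ne_zero_iff, h, cycleMatrix_ne_zero_iff]
      exact Or.inr rfl
  have key : ∀ i, p i = p' i ∧ q i = q' i := by
    intro i
    induction i using Fin.induction with
    | zero => exact ⟨hp, hq⟩
    | succ i ih =>
      rw [← Fin.coeSucc_eq_succ]
      generalize i.castSucc = x at ih ⊢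
      obtain ⟨ihp, ihq⟩ := ih
      have hne := Fin.add_one_ne_self hn x
      have hpx := p.injective.ne hne
      have hqx := q.injective.ne hne
      have hpx' := p'.injective.ne hne
      have hqx' := q'.injective.ne hne
      have hx := adj h x
      have hx' := adj h' x
      have hy := (adj h (x + 1)).1
      have hy' := (adj h' (x + 1)).1
      have hqq : q (x + 1) = q' (x + 1) := by grind
      refine ⟨?_, hqq⟩
      have inj : ∀ u v : Fin (n + 1), u + 1 = v + 1 → u = v := fun u v => add_right_cancel
      grind
  exact ⟨Equiv.ext fun i => (key i).1, Equiv.ext fun i => (key i).2⟩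

theorem stabCard_cycleMatrix_le {n : ℕ} (hn : 1 ≤ n) :
    stabCard (cycleMatrix n) ≤ 2 * (n + 1) := by
  have hcard : Nat.card (Bool × Fin (n + 1)) = 2 * (n + 1) := by simp
  rw [← hcard]
  refine Nat.card_le_card_of_injective (fun x => (decide (x.1.1 0 = x.1.2 0), x.1.1 0)) ?_
  rintro ⟨⟨p, q⟩, h⟩ ⟨⟨p', q'⟩, h'⟩ hxy
  simp only [Prod.mk.injEq, decide_eq_decide] at hxy
  obtain ⟨hd, hp⟩ := hxy
  have h0 : p 0 = q 0 ∨ p 0 + 1 = q 0 := by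
    rw [← cycleMatrix_ne_zero_iff, h, cycleMatrix_ne_zero_iff]
    exact Or.inl rfl
  have h0' : p' 0 = q' 0 ∨ p' 0 + 1 = q' 0 := by
    rw [← cycleMatrix_ne_zero_iff, h', cycleMatrix_ne_zero_iff]
    exact Or.inl rfl
  obtain ⟨rfl, rfl⟩ := eq_of_stab_cycleMatrix hn h h' hp (by grind)
  rfl

/-- χ(k,2) = 2k for k ≥ 3. -/
theorem chi_two (k : ℕ) (hk : 3 ≤ k) :
    IsLeast {m | ∃ N : Fin k → Fin k → ℕ, IsInterMatrix k 2 N ∧ m = autCard N} (2 * k) := by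
  refine ⟨?_, ?_⟩
  · obtain ⟨n, rfl⟩ := Nat.exists_eq_add_of_le' (show 1 ≤ k by omega)
    have hn : 1 ≤ n := by omega
    refine ⟨cycleMatrix n, isInterMatrix_cycleMatrix n, le_antisymm
      ((isInterMatrix_cycleMatrix n).two_mul_le_autCard hk) ?_⟩
    rw [autCard, prod_factorial_cycleMatrix hn, mul_one]
    exact stabCard_cycleMatrix_le hn
  · rintro m ⟨N, hN, rfl⟩
    exact hN.two_mul_le_autCard hk
end

section
/- Let k ≥ 2 and let x and y be distinct fixed-point-free involutions in the symmetric group S_{2k}, and let H = ⟨x, y⟩. Then there exist an integer m ≥ 1, pairwise distinct positive integers k_1, …, k_m, and positive integers l_1, …, l_m with Σ_{i=1}^m k_i l_i = k, such that the centralizer C_{S_{2k}}(H) has order ∏_{i=1}^m (2 k_i)^{l_i} · l_i!. Moreover, if k ≥ 3, then the minimum of |C_{S_{2k}}(⟨x,y⟩)| over all pairs of distinct fixed-point-free involutions x, y in S_{2k} equals 2k. -/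
open MulAction

/-- If stabilizers depend only on the size of the orbit, an equivariant permutation amounts to a
size-preserving permutation `τ` of the orbits and an arbitrary choice, for each orbit `q`, of the
image in `τ q` of a fixed representative of `q`. -/
theorem card_equivariant_perm {G Ω : Type*} [Group G] [MulAction G Ω] [Finite Ω]
    (s : orbitRel.Quotient G Ω → ℕ)
    (hs : ∀ q, s q = Nat.card {a : Ω // (Quotient.mk'' a : orbitRel.Quotient G Ω) = q})
    (hstab : ∀ (g : G) (a b : Ω), s (Quotient.mk'' a) = s (Quotient.mk'' b) →
      g • a = a → g • b = b) [Fintype (orbitRel.Quotient G Ω)] :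
    Nat.card {σ : Equiv.Perm Ω // ∀ (g : G) (a : Ω), σ (g • a) = g • σ a} =
      Nat.card {τ : Equiv.Perm (orbitRel.Quotient G Ω) // s ∘ τ = s} * ∏ q, s q := by
  classical
  let mk : Ω → orbitRel.Quotient G Ω := Quotient.mk''
  have mk_eq (a b : Ω) : mk a = mk b ↔ ∃ g : G, g • b = a := by
    simp only [mk]
    rw [Quotient.eq'', orbitRel_apply, mem_orbit_iff]
  have mk_smul (g : G) (a : Ω) : mk (g • a) = mk a := (mk_eq _ _).2 ⟨g, rfl⟩
  let rep : orbitRel.Quotient G Ω → Ω := Quotient.out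
  have mk_rep (q) : mk (rep q) = q := Quotient.out_eq' q
  have hstab' (g g' : G) (a b : Ω) (hab : s (mk a) = s (mk b)) (h : g • a = g' • a) :
      g • b = g' • b := by
    have := hstab (g'⁻¹ * g) a b hab (by rw [mul_smul, h, inv_smul_smul])
    rwa [mul_smul, inv_smul_eq_iff] at this
  let Φ : {σ : Equiv.Perm Ω // ∀ (g : G) (a : Ω), σ (g • a) = g • σ a} →
    (orbitRel.Quotient G Ω → Ω) := fun σ q => σ.1 (rep q)
  let Ψ : (Σ τ : {τ : Equiv.Perm (orbitRel.Quotient G Ω) // s ∘ τ = s},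
      ∀ q, {a : Ω // mk a = τ.1 q}) → (orbitRel.Quotient G Ω → Ω) := fun p q => (p.2 q).1
  have hΦ : Function.Injective Φ := by
    rintro ⟨σ, hσ⟩ ⟨σ', hσ'⟩ h
    refine Subtype.ext (Equiv.ext fun a => ?_)
    obtain ⟨g, hg⟩ := (mk_eq a (rep (mk a))).1 (mk_rep _).symm
    have := congrFun h (mk a)
    simp only [Φ] at this
    show σ a = σ' a
    rw [← hg, hσ, hσ', this]
  have hΨ : Function.Injective Ψ := by
    rintro ⟨⟨τ, hτ⟩, F⟩ ⟨⟨τ', hτ'⟩, F'⟩ h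
    have hF (q) : (F q).1 = (F' q).1 := congrFun h q
    obtain rfl : τ = τ' := Equiv.ext fun q => by
      rw [← (F q).2, ← (F' q).2, hF]
    obtain rfl : F = F' := funext fun q => Subtype.ext (hF q)
    rfl
  have hrange : Set.range Φ = Set.range Ψ := by
    ext f
    constructor
    · rintro ⟨⟨σ, hσ⟩, rfl⟩
      have hmk (a b : Ω) : mk a = mk b ↔ mk (σ a) = mk (σ b) := by
        rw [mk_eq, mk_eq]
        exact exists_congr fun g => by rw [← hσ, σ.injective.eq_iff]
      let τ : Equiv.Perm (orbitRel.Quotient G Ω) :=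
        Equiv.ofBijective (fun q => mk (σ (rep q))) <| by
          refine Finite.injective_iff_bijective.1 fun q q' h => ?_
          have := (hmk _ _).2 h
          rwa [mk_rep, mk_rep] at this
      refine ⟨⟨⟨τ, funext fun q => ?_⟩, fun q => ⟨σ (rep q), rfl⟩⟩, rfl⟩
      rw [Function.comp_apply, hs, hs]
      refine (Nat.card_congr (σ.subtypeEquiv fun a => ?_)).symm
      show mk a = q ↔ mk (σ a) = mk (σ (rep q))
      rw [← hmk, mk_rep]
    · rintro ⟨⟨⟨τ, hτ⟩, F⟩, rfl⟩
      choose g hg using fun a => (mk_eq a (rep (mk a))).1 (mk_rep _).symm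
      have hsF (q) : s (mk (rep q)) = s (mk (F q).1) := by
        rw [mk_rep, (F q).2]
        exact (congrFun hτ q).symm
      let σ : Equiv.Perm Ω := Equiv.ofBijective (fun a => g a • (F (mk a)).1) <| by
        refine Finite.injective_iff_bijective.1 fun a b h => ?_
        have hab : mk a = mk b := by
          have := congrArg mk h
          simp only [mk_smul] at this
          rw [(F _).2, (F _).2] at this
          exact τ.injective this
        simp only at h
        rw [← hab] at h
        have := hstab' _ _ _ _ (hsF _).symm h
        rw [hg] at this
        rw [this, hab, hg]
      refine ⟨⟨σ, fun h a => ?_⟩, funext fun q => ?_⟩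
      · show g (h • a) • (F (mk (h • a))).1 = h • g a • (F (mk a)).1
        rw [mk_smul, ← mul_smul]
        refine hstab' _ _ (rep (mk a)) _ (hsF _) ?_
        rw [mul_smul, hg]
        conv_rhs => rw [← hg (h • a), mk_smul]
      · show g (rep q) • (F (mk (rep q))).1 = (F q).1
        have h1 := hg (rep q)
        rw [mk_rep] at h1 ⊢
        have := hstab' (g (rep q)) 1 _ _ (hsF q) (by rw [h1, one_smul])
        rwa [one_smul] at this
  rw [← Nat.card_range_of_injective hΦ, hrange, Nat.card_range_of_injective hΨ, Nat.card_sigma]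
  have (τ : {τ : Equiv.Perm (orbitRel.Quotient G Ω) // s ∘ τ = s}) :
      Nat.card (∀ q, {a : Ω // mk a = τ.1 q}) = ∏ q, s q := by
    rw [Nat.card_pi]
    exact Finset.prod_congr rfl fun q _ => (hs _).symm.trans (congrFun τ.2 q)
  simp [this]

section Dihedral

variable {G : Type*} [Group G] {x y : G}

theorem mul_zpow_mul_eq_of_involutions (hx : x * x = 1) (hy : y * y = 1) (n : ℤ) :
    x * (x * y) ^ n = (x * y) ^ (-n) * x := by
  have hx' : x⁻¹ = x := inv_eq_of_mul_eq_one_left hx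
  have hy' : y⁻¹ = y := inv_eq_of_mul_eq_one_left hy
  have h : SemiconjBy x (x * y) (x * y)⁻¹ := by
    rw [SemiconjBy, mul_inv_rev, hx', hy', mul_assoc y, hx, ← mul_assoc, hx, one_mul, mul_one]
  rw [zpow_neg, ← inv_zpow]
  exact (h.zpow_right n).eq

theorem exists_zpow_of_mem_closure_involutions (hx : x * x = 1) (hy : y * y = 1) {g : G}
    (hg : g ∈ Subgroup.closure {x, y}) :
    ∃ n : ℤ, g = (x * y) ^ n ∨ g = (x * y) ^ n * x := by
  have hx' : x⁻¹ = x := inv_eq_of_mul_eq_one_left hx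
  have hy' : y⁻¹ = y := inv_eq_of_mul_eq_one_left hy
  have key (g : G) (h : ∃ n : ℤ, g = (x * y) ^ n ∨ g = (x * y) ^ n * x) (z : G)
      (hz : z ∈ ({x, y} : Set G)) :
      ∃ n : ℤ, g * z = (x * y) ^ n ∨ g * z = (x * y) ^ n * x := by
    obtain ⟨n, rfl | rfl⟩ := h <;> obtain rfl | rfl := hz
    · exact ⟨n, .inr rfl⟩
    · refine ⟨n - 1, .inr ?_⟩
      rw [zpow_sub_one, mul_inv_rev, hx', hy', mul_assoc, mul_assoc, hx, mul_one]
    · exact ⟨n, .inl (by rw [mul_assoc, hx, mul_one])⟩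
    · exact ⟨n + 1, .inl (by rw [zpow_add_one, mul_assoc])⟩
  induction hg using Subgroup.closure_induction_right with
  | one => exact ⟨0, .inl (zpow_zero _).symm⟩
  | mul_right g _ z hz ih => exact key g ih z hz
  | mul_inv_cancel g _ z hz ih =>
    have : z⁻¹ = z := by obtain rfl | rfl := hz <;> assumption
    rw [this]
    exact key g ih z hz

variable {Ω : Type*} [MulAction G Ω]

theorem zpow_mul_smul_ne (hx : x * x = 1) (hy : y * y = 1) (hxf : ∀ a : Ω, x • a ≠ a)
    (hyf : ∀ a : Ω, y • a ≠ a) (n : ℤ) (a : Ω) : ((x * y) ^ n * x) • a ≠ a := by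
  intro h
  have hcomm := mul_zpow_mul_eq_of_involutions hx hy
  obtain ⟨j, rfl | rfl⟩ := Int.even_or_odd' n
  · refine hxf ((x * y) ^ (-j) • a) ?_
    rw [← mul_smul, hcomm, neg_neg, zpow_neg, eq_inv_smul_iff, ← mul_smul, ← mul_assoc,
      ← zpow_add, ← two_mul, h]
  · refine hyf (x • (x * y) ^ (-j) • a) ?_
    have e : (x * y) ^ (2 * j + 1) * x = (x * y) ^ j * x * (y * x * (x * y) ^ (-j)) := by
      rw [mul_assoc y, hcomm, neg_neg, two_mul, add_assoc, zpow_add, add_comm j 1, zpow_add,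
        zpow_one]
      simp only [mul_assoc]
    have e' : ((x * y) ^ j * x)⁻¹ = x * (x * y) ^ (-j) := by
      rw [mul_inv_rev, zpow_neg, inv_eq_of_mul_eq_one_left hx]
    rw [← mul_smul x, ← e', eq_inv_smul_iff, e', ← mul_smul, ← mul_smul]
    rw [e] at h
    simpa only [mul_assoc] using h

theorem ncard_orbit_closure_involutions [Finite Ω] (hx : x * x = 1) (hy : y * y = 1)
    (hxf : ∀ a : Ω, x • a ≠ a) (hyf : ∀ a : Ω, y • a ≠ a) (a : Ω) :
    (orbit (Subgroup.closure {x, y}) a).ncard =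
      2 * Function.minimalPeriod ((x * y) • ·) a := by
  have hxm : x ∈ Subgroup.closure {x, y} := Subgroup.subset_closure (by simp)
  have hym : y ∈ Subgroup.closure {x, y} := Subgroup.subset_closure (by simp)
  have hunion : orbit (Subgroup.closure {x, y}) a =
      orbit (Subgroup.zpowers (x * y)) a ∪ orbit (Subgroup.zpowers (x * y)) (x • a) := by
    ext b
    constructor
    · rintro ⟨⟨g, hg⟩, rfl⟩
      obtain ⟨n, rfl | rfl⟩ := exists_zpow_of_mem_closure_involutions hx hy hg
      · exact .inl ⟨⟨_, n, rfl⟩, rfl⟩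
      · exact .inr ⟨⟨_, n, rfl⟩, (mul_smul _ _ _).symm⟩
    · rintro (⟨⟨_, n, rfl⟩, rfl⟩ | ⟨⟨_, n, rfl⟩, rfl⟩)
      · exact ⟨⟨_, zpow_mem (mul_mem hxm hym) n⟩, rfl⟩
      · exact ⟨⟨_, mul_mem (zpow_mem (mul_mem hxm hym) n) hxm⟩, mul_smul _ _ _⟩
  have hdisj : Disjoint (orbit (Subgroup.zpowers (x * y)) a)
      (orbit (Subgroup.zpowers (x * y)) (x • a)) := by
    refine (orbit.eq_or_disjoint _ _).resolve_left fun h => ?_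
    have ha : a ∈ orbit (Subgroup.zpowers (x * y)) (x • a) := h ▸ mem_orbit_self a
    obtain ⟨⟨_, n, rfl⟩, h⟩ := ha
    refine zpow_mul_smul_ne hx hy hxf hyf n a ?_
    rw [mul_smul]
    exact h
  have hcard (b : Ω) : (orbit (Subgroup.zpowers (x * y)) b).ncard =
      Function.minimalPeriod ((x * y) • ·) b := by
    cases nonempty_fintype (orbit (Subgroup.zpowers (x * y)) b)
    rw [minimalPeriod_eq_card, ← Nat.card_eq_fintype_card, Nat.card_coe_set_eq]
  have hper : Function.minimalPeriod ((x * y) • ·) (x • a) =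
      Function.minimalPeriod ((x * y) • ·) a := by
    refine Nat.dvd_right_iff_eq.1 fun n => ?_
    rw [← pow_smul_eq_iff_minimalPeriod_dvd, ← pow_smul_eq_iff_minimalPeriod_dvd, ← zpow_natCast,
      ← neg_neg (n : ℤ), ← mul_smul, ← mul_zpow_mul_eq_of_involutions hx hy, mul_smul,
      smul_left_cancel_iff, neg_neg, zpow_neg, inv_smul_eq_iff, eq_comm]
  rw [hunion, Set.ncard_union_eq hdisj, hcard, hcard, hper, two_mul]

theorem smul_eq_of_ncard_orbit_eq [Finite Ω] (hx : x * x = 1) (hy : y * y = 1)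
    (hxf : ∀ a : Ω, x • a ≠ a) (hyf : ∀ a : Ω, y • a ≠ a) (g : Subgroup.closure {x, y}) (a b : Ω)
    (hab : (orbit (Subgroup.closure {x, y}) a).ncard = (orbit (Subgroup.closure {x, y}) b).ncard)
    (h : g • a = a) : g • b = b := by
  obtain ⟨g, hg⟩ := g
  rw [Subgroup.mk_smul] at h ⊢
  rw [ncard_orbit_closure_involutions hx hy hxf hyf,
    ncard_orbit_closure_involutions hx hy hxf hyf] at hab
  obtain ⟨n, rfl | rfl⟩ := exists_zpow_of_mem_closure_involutions hx hy hg
  · rw [zpow_smul_eq_iff_minimalPeriod_dvd] at h ⊢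
    rwa [← Nat.eq_of_mul_eq_mul_left two_pos hab]
  · exact absurd h (zpow_mul_smul_ne hx hy hxf hyf n a)

end Dihedral

theorem exists_card_centralizer_closure_involutions {Ω : Type*} [Finite Ω]
    {x y : Equiv.Perm Ω} (hx : x * x = 1) (hy : y * y = 1) (hxf : ∀ a, x a ≠ a)
    (hyf : ∀ a, y a ≠ a) [Fintype (orbitRel.Quotient (Subgroup.closure {x, y}) Ω)] :
    ∃ t : orbitRel.Quotient (Subgroup.closure {x, y}) Ω → ℕ, (∀ q, 1 ≤ t q) ∧
      ∑ q, 2 * t q = Nat.card Ω ∧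
      Nat.card (Subgroup.centralizer (Subgroup.closure {x, y} : Set (Equiv.Perm Ω))) =
        Nat.card {τ : Equiv.Perm (orbitRel.Quotient (Subgroup.closure {x, y}) Ω) // t ∘ τ = t} *
          ∏ q, 2 * t q := by
  let t : orbitRel.Quotient (Subgroup.closure {x, y}) Ω → ℕ := fun q =>
    Function.minimalPeriod ((x * y) • ·) q.out
  have hfib (a : Ω) : Nat.card {b : Ω // (Quotient.mk'' b :
      orbitRel.Quotient (Subgroup.closure {x, y}) Ω) = Quotient.mk'' a} =
      (orbit (Subgroup.closure {x, y}) a).ncard := by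
    rw [← Nat.card_coe_set_eq]
    exact Nat.card_congr (Equiv.subtypeEquivRight fun b => by rw [Quotient.eq'', orbitRel_apply])
  have ht (q) : 2 * t q = Nat.card {b : Ω // (Quotient.mk'' b :
      orbitRel.Quotient (Subgroup.closure {x, y}) Ω) = q} := by
    rw [← ncard_orbit_closure_involutions hx hy hxf hyf, ← hfib, Quotient.out_eq']
  refine ⟨t, fun q => ?_, ?_, ?_⟩
  · have : 0 < Nat.card {b : Ω // (Quotient.mk'' b :
        orbitRel.Quotient (Subgroup.closure {x, y}) Ω) = q} :=
      have : Nonempty {b : Ω // (Quotient.mk'' b :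
        orbitRel.Quotient (Subgroup.closure {x, y}) Ω) = q} := ⟨q.out, Quotient.out_eq' q⟩
      Nat.card_pos
    have := ht q
    lia
  · simp_rw [ht]
    rw [← Nat.card_sigma]
    exact Nat.card_congr (Equiv.sigmaFiberEquiv _)
  · have hτ (τ : Equiv.Perm (orbitRel.Quotient (Subgroup.closure {x, y}) Ω)) :
        t ∘ τ = t ↔ (fun q => 2 * t q) ∘ τ = fun q => 2 * t q := by
      simp [funext_iff]
    simp_rw [hτ]
    rw [← card_equivariant_perm _ ht]
    · refine Nat.card_congr (Equiv.subtypeEquivRight fun σ => ?_)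
      rw [Subgroup.mem_centralizer_iff]
      refine ⟨fun h g a => (DFunLike.congr_fun (h g.1 g.2) a).symm,
        fun h g hg => Equiv.ext fun a => (h ⟨g, hg⟩ a).symm⟩
    · intro g a b hab
      rw [ht, ht, hfib, hfib] at hab
      exact smul_eq_of_ncard_orbit_eq hx hy hxf hyf g a b hab

theorem Finset.sum_le_prod_of_two_le {ι : Type*} (s : Finset ι) (f : ι → ℕ)
    (hf : ∀ i ∈ s, 2 ≤ f i) : ∑ i ∈ s, f i ≤ ∏ i ∈ s, f i := by
  classical
  induction s using Finset.induction_on with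
  | empty => simp
  | insert a s ha ih =>
    rw [Finset.sum_insert ha, Finset.prod_insert ha]
    have ih := ih fun i hi => hf i (Finset.mem_insert_of_mem hi)
    have h2 := hf a (Finset.mem_insert_self a s)
    obtain rfl | ⟨b, hb⟩ := s.eq_empty_or_nonempty
    · simp
    · have : 2 ≤ ∏ i ∈ s, f i :=
        (hf b (Finset.mem_insert_of_mem hb)).trans
          ((Finset.single_le_sum (fun _ _ => Nat.zero_le _) hb).trans ih)
      nlinarith

/-- Perfect matchings of the `2k`-gon given by two adjacent reflections without fixed vertices. -/
theorem exists_transitive_pair_involutions_zmod (k : ℕ) (hk : 2 ≤ k) :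
    ∃ x y : Equiv.Perm (ZMod (2 * k)), x ≠ y ∧ x * x = 1 ∧ (∀ a, x a ≠ a) ∧ y * y = 1 ∧
      (∀ a, y a ≠ a) ∧ IsPretransitive (Subgroup.closure {x, y}) (ZMod (2 * k)) := by
  have : NeZero (2 * k) := ⟨by lia⟩
  have hparity (a : ZMod (2 * k)) : a + a ≠ 1 := fun h => by
    have := congrArg (ZMod.castHom (Dvd.intro k rfl) (ZMod 2)) h
    rw [map_add, map_one, CharTwo.add_self_eq_zero] at this
    exact zero_ne_one this
  let x : Equiv.Perm (ZMod (2 * k)) := Equiv.subLeft 1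
  let y : Equiv.Perm (ZMod (2 * k)) := Equiv.subLeft (-1)
  have hx (a) : x a = 1 - a := rfl
  have hy (a) : y a = -1 - a := rfl
  refine ⟨x, y, fun h => ?_, Equiv.ext fun a => ?_, fun a h => ?_, Equiv.ext fun a => ?_,
    fun a h => ?_, ?_⟩
  · have h0 : (1 : ZMod (2 * k)) - 0 = -1 - 0 := DFunLike.congr_fun h 0
    have h2 : ((2 : ℕ) : ZMod (2 * k)) = 0 := by push_cast; linear_combination h0
    rw [ZMod.natCast_eq_zero_iff] at h2
    have := Nat.le_of_dvd two_pos h2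
    lia
  · simp [hx]
  · rw [hx] at h
    exact hparity a (by linear_combination -h)
  · simp [hy]
  · rw [hy] at h
    exact hparity (a + 1) (by linear_combination -h)
  · have hxm : x ∈ Subgroup.closure {x, y} := Subgroup.subset_closure (by simp)
    have hym : y ∈ Subgroup.closure {x, y} := Subgroup.subset_closure (by simp)
    have hmem (n : ℕ) : ∃ g : Subgroup.closure {x, y}, g • (0 : ZMod (2 * k)) = n := by
      induction n using Nat.twoStepInduction with
      | zero => exact ⟨1, by simp⟩
      | one => exact ⟨⟨x, hxm⟩, by simp [Subgroup.mk_smul, hx]⟩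
      | more n ih _ =>
        obtain ⟨g, hg⟩ := ih
        refine ⟨⟨x, hxm⟩ * ⟨y, hym⟩ * g, ?_⟩
        rw [mul_smul, hg, mul_smul, Subgroup.mk_smul, Subgroup.mk_smul, Equiv.Perm.smul_def,
          Equiv.Perm.smul_def, hx, hy]
        push_cast
        ring
    refine (isPretransitive_iff_base (0 : ZMod (2 * k))).2 fun a => ?_
    obtain ⟨g, hg⟩ := hmem a.val
    exact ⟨g, by rw [hg, ZMod.natCast_zmod_val]⟩

theorem exists_transitive_pair_involutions_fin (k : ℕ) (hk : 2 ≤ k) :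
    ∃ x y : Equiv.Perm (Fin (2 * k)), x ≠ y ∧ x * x = 1 ∧ (∀ a, x a ≠ a) ∧ y * y = 1 ∧
      (∀ a, y a ≠ a) ∧ IsPretransitive (Subgroup.closure {x, y}) (Fin (2 * k)) := by
  obtain ⟨l, rfl⟩ : ∃ l, k = l + 1 := ⟨k - 1, by lia⟩
  exact exists_transitive_pair_involutions_zmod (l + 1) hk

theorem card_centralizer_of_isPretransitive {Ω : Type*} [Finite Ω] [Nonempty Ω]
    {x y : Equiv.Perm Ω} (hx : x * x = 1) (hy : y * y = 1) (hxf : ∀ a, x a ≠ a)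
    (hyf : ∀ a, y a ≠ a) (h : IsPretransitive (Subgroup.closure {x, y}) Ω) :
    Nat.card (Subgroup.centralizer (Subgroup.closure {x, y} : Set (Equiv.Perm Ω))) =
      Nat.card Ω := by
  have hsub := pretransitive_iff_subsingleton_quotient (Subgroup.closure {x, y}) Ω |>.1 h
  have hne : Nonempty (orbitRel.Quotient (Subgroup.closure {x, y}) Ω) :=
    (inferInstance : Nonempty Ω).map Quotient.mk''
  have : Unique (orbitRel.Quotient (Subgroup.closure {x, y}) Ω) :=
    Classical.choice ((unique_iff_subsingleton_and_nonempty _).2 ⟨hsub, hne⟩)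
  obtain ⟨t, -, hsum, hcard⟩ := exists_card_centralizer_closure_involutions hx hy hxf hyf
  have h1 : Nat.card {τ : Equiv.Perm (orbitRel.Quotient (Subgroup.closure {x, y}) Ω) //
      t ∘ τ = t} = 1 := by
    rw [Nat.card_eq_one_iff_unique]
    exact ⟨inferInstance, ⟨1, rfl⟩⟩
  rw [hcard, h1, one_mul, ← hsum, Fintype.prod_unique, Fintype.sum_unique]

theorem card_le_card_centralizer_closure_involutions {Ω : Type*} [Finite Ω]
    {x y : Equiv.Perm Ω} (hx : x * x = 1) (hy : y * y = 1) (hxf : ∀ a, x a ≠ a)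
    (hyf : ∀ a, y a ≠ a) :
    Nat.card Ω ≤
      Nat.card (Subgroup.centralizer (Subgroup.closure {x, y} : Set (Equiv.Perm Ω))) := by
  cases nonempty_fintype (orbitRel.Quotient (Subgroup.closure {x, y}) Ω)
  obtain ⟨t, ht, hsum, hcard⟩ := exists_card_centralizer_closure_involutions hx hy hxf hyf
  have : Nonempty {τ : Equiv.Perm (orbitRel.Quotient (Subgroup.closure {x, y}) Ω) //
      t ∘ τ = t} := ⟨1, rfl⟩
  rw [hcard, ← hsum]
  exact (Finset.sum_le_prod_of_two_le _ _ fun q _ => by have := ht q; lia).trans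
    (Nat.le_mul_of_pos_left _ Nat.card_pos)

/-- Grouping the values of `t` into distinct values with multiplicities. -/
theorem exists_distinct_values_with_multiplicity {Q : Type*} [Fintype Q] [Nonempty Q]
    (t : Q → ℕ) :
    ∃ (m : ℕ) (ks ls : Fin m → ℕ), 1 ≤ m ∧ Function.Injective ks ∧ (∀ i, ∃ q, t q = ks i) ∧
      (∀ i, 1 ≤ ls i) ∧ ∑ i, ks i * ls i = ∑ q, t q ∧
      Nat.card {τ : Equiv.Perm Q // t ∘ τ = t} * ∏ q, 2 * t q =
        ∏ i, (2 * ks i) ^ ls i * (ls i).factorial := by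
  classical
  let T : Finset ℕ := Finset.univ.image t
  let e : T ≃ Fin T.card := T.equivFin
  let l : ℕ → ℕ := fun n => Finset.card {q | t q = n}
  have hT (i : Fin T.card) : ∃ q, t q = e.symm i := by
    obtain ⟨q, -, hq⟩ := Finset.mem_image.1 (e.symm i).2
    exact ⟨q, hq⟩
  refine ⟨T.card, fun i => e.symm i, fun i => l (e.symm i), ?_, ?_, hT, fun i => ?_, ?_, ?_⟩
  · exact Finset.card_pos.2 (Finset.univ_nonempty.image t)
  · exact Subtype.val_injective.comp e.symm.injective
  · obtain ⟨q, hq⟩ := hT i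
    exact Finset.card_pos.2 ⟨q, by simpa using hq⟩
  · rw [e.symm.sum_comp (fun n : T => (n : ℕ) * l n), Finset.sum_coe_sort T (fun n => n * l n),
      Finset.sum_comp (fun n => n) t]
    exact Finset.sum_congr rfl fun n _ => by rw [smul_eq_mul, mul_comm]
  · rw [e.symm.prod_comp (fun n : T => (2 * (n : ℕ)) ^ l n * (l n).factorial),
      Finset.prod_coe_sort T (fun n => (2 * n) ^ l n * (l n).factorial),
      Finset.prod_comp (fun n => 2 * n) t, Finset.prod_mul_distrib, Nat.card_eq_fintype_card,
      DomMulAct.stabilizer_card', mul_comm]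
    simp only [Fintype.card_subtype, T, l]

/-- For distinct fixed-point-free involutions `x, y ∈ S_{2k}` with `H = ⟨x, y⟩`, the
centralizer `C_{S_{2k}}(H)` has order `∏ (2 kᵢ)^{lᵢ} · lᵢ!` for some data as described;
moreover for `k ≥ 3` the minimum of such centralizer orders over all pairs of distinct
fixed-point-free involutions is `2k`. -/
theorem centralizer_of_two_fpf_involutions (k : ℕ) (hk : 2 ≤ k)
    (x y : Equiv.Perm (Fin (2 * k))) (hxy : x ≠ y)
    (hx2 : x * x = 1) (hxf : ∀ a, x a ≠ a)
    (hy2 : y * y = 1) (hyf : ∀ a, y a ≠ a) :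
    (∃ (m : ℕ) (ks ls : Fin m → ℕ), 1 ≤ m ∧
      Function.Injective ks ∧ (∀ i, 1 ≤ ks i) ∧ (∀ i, 1 ≤ ls i) ∧
      (∑ i, ks i * ls i) = k ∧
      Nat.card (Subgroup.centralizer
          ((Subgroup.closure {x, y} : Subgroup (Equiv.Perm (Fin (2 * k)))) :
            Set (Equiv.Perm (Fin (2 * k)))))
        = ∏ i, (2 * ks i) ^ ls i * (ls i).factorial) ∧
    (3 ≤ k →
      IsLeast {c | ∃ x' y' : Equiv.Perm (Fin (2 * k)), x' ≠ y' ∧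
          x' * x' = 1 ∧ (∀ a, x' a ≠ a) ∧ y' * y' = 1 ∧ (∀ a, y' a ≠ a) ∧
          c = Nat.card (Subgroup.centralizer
            ((Subgroup.closure {x', y'} : Subgroup (Equiv.Perm (Fin (2 * k)))) :
              Set (Equiv.Perm (Fin (2 * k)))))}
        (2 * k)) := by
  constructor
  · cases nonempty_fintype (orbitRel.Quotient (Subgroup.closure {x, y}) (Fin (2 * k)))
    have : Nonempty (orbitRel.Quotient (Subgroup.closure {x, y}) (Fin (2 * k))) :=
      ⟨Quotient.mk'' ⟨0, by lia⟩⟩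
    obtain ⟨t, ht, hsum, hcard⟩ := exists_card_centralizer_closure_involutions hx2 hy2 hxf hyf
    obtain ⟨m, ks, ls, hm, hinj, hks, hls, hsum', hprod⟩ :=
      exists_distinct_values_with_multiplicity t
    refine ⟨m, ks, ls, hm, hinj, fun i => ?_, hls, ?_, hcard.trans hprod⟩
    · obtain ⟨q, hq⟩ := hks i
      exact hq ▸ ht q
    · rw [← Finset.mul_sum, Nat.card_fin] at hsum
      exact hsum'.trans (Nat.eq_of_mul_eq_mul_left two_pos hsum)
  · intro _
    constructor
    · obtain ⟨x', y', hne, hx', hxf', hy', hyf', htrans⟩ :=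
        exists_transitive_pair_involutions_fin k hk
      have : Nonempty (Fin (2 * k)) := ⟨⟨0, by lia⟩⟩
      refine ⟨x', y', hne, hx', hxf', hy', hyf', ?_⟩
      rw [card_centralizer_of_isPretransitive hx' hy' hxf' hyf' htrans, Nat.card_fin]
    · rintro c ⟨x', y', -, hx', hxf', hy', hyf', rfl⟩
      simpa using card_le_card_centralizer_closure_involutions hx' hy' hxf' hyf'
end

section
/- Let k ≥ 8 and l ≥ 2 be integers and write l = qk + r with 3 ≤ r ≤ k−3. Then the minimum over all (k,l)-intersection matrices N of |K_N| · ∏_{i,j} N_{i,j}! equals (q+1)!^{rk} · q!^{k²−rk}; that is, χ(k,l) = (q+1)!^{rk} q!^{k²−rk}. Moreover, every (k,l)-intersection matrix N attaining this minimum has trivial stabilizer K_N, and its multiset of entries consists of rk entries equal to q+1 and k²−rk entries equal to q. -/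
/-- The multiset of entries of a `k × k` matrix. -/
def entries {k : ℕ} (N : Fin k → Fin k → ℕ) : Multiset ℕ :=
  (Finset.univ : Finset (Fin k × Fin k)).val.map fun p => N p.1 p.2

/-- The first row has at most one entry outside the second. -/
def DiffLeOne (k : ℕ) (A : ℕ → ℕ → Prop) (i i' : ℕ) : Prop :=
  ∀ j₁ < k, ∀ j₂ < k, A i j₁ → ¬ A i' j₁ → A i j₂ → ¬ A i' j₂ → j₁ = j₂

/-- The first row has at most two entries outside the second. -/
def DiffLeTwo (k : ℕ) (A : ℕ → ℕ → Prop) (i i' : ℕ) : Prop :=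
  ∀ j₁ < k, ∀ j₂ < k, ∀ j₃ < k, A i j₁ → ¬ A i' j₁ → A i j₂ → ¬ A i' j₂ → A i j₃ → ¬ A i' j₃ →
    j₁ = j₂ ∨ j₁ = j₃ ∨ j₂ = j₃

/-- The circulant relation whose row `i` is the cyclic interval `i, …, i + r - 1` modulo `k`. -/
def circBand (k r i j : ℕ) : Prop := (i ≤ j ∧ j < i + r) ∨ j + k < i + r

/-- The band with a switch in rows `0`, `3` and columns `1`, `r`. -/
def wideBand (k r i j : ℕ) : Prop :=
  (i ≠ 0 ∧ i ≠ 3 ∧ circBand k r i j) ∨ (i = 0 ∧ (j = 0 ∨ 2 ≤ j ∧ j ≤ r)) ∨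
    (i = 3 ∧ (j = 1 ∨ 3 ≤ j ∧ j ≤ r + 2 ∧ j ≠ r))

/-- The band of width three with a switch in rows `0`, `4` and columns `0`, `5`. -/
def narrowBand (k i j : ℕ) : Prop :=
  (i ≠ 0 ∧ i ≠ 4 ∧ circBand k 3 i j) ∨ (i = 0 ∧ (j = 1 ∨ j = 2 ∨ j = 5)) ∨
    (i = 4 ∧ (j = 0 ∨ j = 4 ∨ j = 6))

section
variable {k r : ℕ}

lemma wideBand_diffLeOne_succ (h4 : 4 ≤ r) (hk : 2 * r ≤ k) {i : ℕ} (hi : 4 ≤ i) (hik : i + 1 < k) :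
    DiffLeOne k (wideBand k r) i (i + 1) := by
  intro j₁ h₁ j₂ h₂
  unfold wideBand circBand
  omega

lemma wideBand_diffLeOne_pred (h4 : 4 ≤ r) (hk : 2 * r ≤ k) {i : ℕ} (hi : 4 ≤ i) (hik : i + 1 < k) :
    DiffLeOne k (wideBand k r) (i + 1) i := by
  intro j₁ h₁ j₂ h₂
  unfold wideBand circBand
  omega

lemma eq_or_succ_of_wideBand_diffLeOne (h4 : 4 ≤ r) (hk : 2 * r ≤ k) {i i' : ℕ}
    (hi : 4 ≤ i) (hik : i + 1 < k) (hi'k : i' < k) (h : DiffLeOne k (wideBand k r) i i') : i' + 1 = i ∨ i' = i ∨ i' = i + 1 := by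
  by_contra hc
  by_cases h3 : i' = 3
  · subst h3
    rcases (show i = 4 ∨ (5 ≤ i ∧ i + r ≤ k) ∨ (5 ≤ i ∧ k < i + r) by omega) with h' | h' | h'
    · have := h r (by omega) (r + 3) (by omega)
      unfold wideBand circBand at this
      omega
    · have := h (i + r - 1) (by omega) (i + r - 2) (by omega)
      unfold wideBand circBand at this
      omega
    · have := h (k - 1) (by omega) 0 (by omega)
      unfold wideBand circBand at this
      omega
  · rcases (show (i < i' ∧ i' + r ≤ i + k) ∨ (i < i' ∧ i + k < i' + r) ∨ (i' < i ∧ i + r ≤ k) ∨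
      (i' < i ∧ i + r = k + 1) ∨ (i' < i ∧ k + 1 < i + r ∧ i + r - k ≤ i') ∨
      (i' < i ∧ i' + k < i + r) by omega) with h' | h' | h' | h' | h' | h'
    · have := h i (by omega) (i + 1) (by omega)
      unfold wideBand circBand at this
      omega
    · have := h (i + r - 1) (by omega) (i + r - 2) (by omega)
      unfold wideBand circBand at this
      omega
    · have := h (i + r - 1) (by omega) (i + r - 2) (by omega)
      unfold wideBand circBand at this
      omega
    · by_cases hz : i' = 0
      · have := h i (by omega) (i + 1) (by omega)
        unfold wideBand circBand at this
        omega
      have := h (k - 1) (by omega) 0 (by omega)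
      unfold wideBand circBand at this
      omega
    · have := h (i + r - 1 - k) (by omega) (i + r - 2 - k) (by omega)
      unfold wideBand circBand at this
      omega
    · have := h i (by omega) (i + 1) (by omega)
      unfold wideBand circBand at this
      omega

/-- `s` permutes `{0, …, k - 1}` preserving `DiffLeOne` and `DiffLeTwo`. -/
structure PreservesDiff (k : ℕ) (A : ℕ → ℕ → Prop) (s : ℕ → ℕ) : Prop where
  lt : ∀ i < k, s i < k
  inj : ∀ i < k, ∀ i' < k, s i = s i' → i = i'
  surj : ∀ i < k, ∃ i' < k, s i' = i
  one : ∀ i < k, ∀ i' < k, (DiffLeOne k A (s i) (s i') ↔ DiffLeOne k A i i')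
  two : ∀ i < k, ∀ i' < k, (DiffLeTwo k A (s i) (s i') ↔ DiffLeTwo k A i i')

lemma PreservesDiff.eq_of_path {A : ℕ → ℕ → Prop} {s : ℕ → ℕ} (hs : PreservesDiff k A s)
    {a b : ℕ} (hb : b < k) (ha : s a = a)
    (near : ∀ i, a ≤ i → i < b → DiffLeOne k A i (i + 1))
    (far : ∀ i i', a ≤ i → i < b → i' < k → DiffLeOne k A i i' →
      i' = i ∨ i' = i + 1 ∨ (a < i ∧ i' + 1 = i)) (i : ℕ) (hai : a ≤ i) (hib : i ≤ b) :
    s i = i := by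
  induction i using Nat.strong_induction_on with
  | _ i ih =>
    rcases Nat.eq_or_lt_of_le hai with rfl | hlt
    · exact ha
    obtain ⟨n, rfl⟩ : ∃ n, i = n + 1 := ⟨i - 1, by omega⟩
    have hn := ih n (by omega) (by omega) (by omega)
    have h1 := (hs.one n (by omega) (n + 1) (by omega)).2 (near n (by omega) (by omega))
    rw [hn] at h1
    rcases far n _ (by omega) (by omega) (hs.lt _ (by omega)) h1 with h | h | ⟨h, h'⟩
    · have := hs.inj (n + 1) (by omega) n (by omega) (h.trans hn.symm)
      omega
    · exact h
    · have hp := ih (n - 1) (by omega) (by omega) (by omega)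
      have := hs.inj (n + 1) (by omega) (n - 1) (by omega) (by omega)
      omega

lemma eq_three_of_wideBand_diffLeOne (h4 : 4 ≤ r) (hk : 2 * r ≤ k) {i' : ℕ} (hi'k : i' < k)
    (h : DiffLeOne k (wideBand k r) 3 i') : i' = 3 := by
  by_contra hc
  rcases (show i' = 0 ∨ i' = 1 ∨ i' = 2 ∨ i' = 4 ∨ 5 ≤ i' by omega) with h' | h' | h' | h' | h'
  · have := h (r + 1) (by omega) (r + 2) (by omega)
    unfold wideBand circBand at this
    omega
  · have := h (r + 1) (by omega) (r + 2) (by omega)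
    unfold wideBand circBand at this
    omega
  · have := h 1 (by omega) (r + 2) (by omega)
    unfold wideBand circBand at this
    omega
  · have := h 1 (by omega) 3 (by omega)
    unfold wideBand circBand at this
    omega
  · by_cases hw : i' + r ≤ k + 1
    · have := h 1 (by omega) 3 (by omega)
      unfold wideBand circBand at this
      omega
    · by_cases hw' : i' + r ≤ k + 3
      · have := h 3 (by omega) (r + 1) (by omega)
        unfold wideBand circBand at this
        omega
      · have := h (r + 1) (by omega) (r + 2) (by omega)
        unfold wideBand circBand at this
        omega

lemma exists_wideBand_diffLeOne (h4 : 4 ≤ r) (hk : 2 * r ≤ k) {i : ℕ} (hik : i < k) (hi : i ≠ 3) :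
    ∃ i' < k, i' ≠ i ∧ DiffLeOne k (wideBand k r) i i' := by
  rcases (show i = 0 ∨ i = 1 ∨ i = 2 ∨ 4 ≤ i ∧ i + 1 < k ∨ i = k - 1 by omega)
    with h' | h' | h' | h' | h'
  · refine ⟨1, by omega, by omega, fun j₁ h₁ j₂ h₂ => ?_⟩
    unfold wideBand circBand
    omega
  · refine ⟨2, by omega, by omega, fun j₁ h₁ j₂ h₂ => ?_⟩
    unfold wideBand circBand
    omega
  · refine ⟨1, by omega, by omega, fun j₁ h₁ j₂ h₂ => ?_⟩
    unfold wideBand circBand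
    omega
  · exact ⟨i + 1, by omega, by omega, wideBand_diffLeOne_succ h4 hk h'.1 h'.2⟩
  · refine ⟨k - 2, by omega, by omega, ?_⟩
    have := wideBand_diffLeOne_pred h4 hk (i := k - 2) (by omega) (by omega)
    rwa [show k - 2 + 1 = i by omega] at this

lemma eq_four_of_wideBand_leaf (h4 : 4 ≤ r) (hk : 2 * r ≤ k) {i : ℕ} (hik : i < k) (hi : i ≠ 3)
    (h2 : DiffLeTwo k (wideBand k r) i 3)
    (h : ∀ a < k, ∀ b < k, a ≠ i → b ≠ i → DiffLeOne k (wideBand k r) i a →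
      DiffLeOne k (wideBand k r) i b → a = b) : i = 4 := by
  rcases (show i = 0 ∨ i = 1 ∨ i = 2 ∨ i = 4 ∨ 5 ≤ i ∧ i + 1 < k ∨ i = k - 1 by omega)
    with h' | h' | h' | h' | h' | h'
  · have := h2 0 (by omega) 2 (by omega) r (by omega)
    unfold wideBand circBand at this
    omega
  · have := h 0 (by omega) 2 (by omega) (by omega) (by omega)
      (by intro j₁ h₁ j₂ h₂; unfold wideBand circBand; omega)
      (by intro j₁ h₁ j₂ h₂; unfold wideBand circBand; omega)
    omega
  · have := h 0 (by omega) 1 (by omega) (by omega) (by omega)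
      (by intro j₁ h₁ j₂ h₂; unfold wideBand circBand; omega)
      (by intro j₁ h₁ j₂ h₂; unfold wideBand circBand; omega)
    omega
  · exact h'
  · have := wideBand_diffLeOne_pred h4 hk (i := i - 1) (by omega) (by omega)
    rw [show i - 1 + 1 = i by omega] at this
    have := h (i - 1) (by omega) (i + 1) (by omega) (by omega) (by omega) this
      (wideBand_diffLeOne_succ h4 hk (by omega) h'.2)
    omega
  · have := h2 0 (by omega) 2 (by omega) (k - 1) (by omega)
    unfold wideBand circBand at this
    omega

lemma not_wideBand_diffLeOne_four_three (h4 : 4 ≤ r) (hk : 2 * r ≤ k) :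
    ¬ DiffLeOne k (wideBand k r) 4 3 := fun h => by
  have := h r (by omega) (r + 3) (by omega)
  unfold wideBand circBand at this
  omega

lemma eq_self_of_preservesDiff_wideBand (h4 : 4 ≤ r) (hk : 2 * r ≤ k) {s : ℕ → ℕ}
    (hs : PreservesDiff k (wideBand k r) s) : ∀ i < k, s i = i := by
  have s3 : s 3 = 3 := by
    by_contra hc
    obtain ⟨i', hi', hne, hd⟩ := exists_wideBand_diffLeOne h4 hk (hs.lt 3 (by omega)) hc
    obtain ⟨u, hu, rfl⟩ := hs.surj i' hi'
    rw [hs.one 3 (by omega) u hu] at hd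
    exact hne (by rw [eq_three_of_wideBand_diffLeOne h4 hk hu hd])
  have s4 : s 4 = 4 := by
    refine eq_four_of_wideBand_leaf h4 hk (hs.lt 4 (by omega)) ?_ ?_ ?_
    · intro h
      have := hs.inj 4 (by omega) 3 (by omega) (h.trans s3.symm)
      omega
    · rw [show DiffLeTwo k (wideBand k r) (s 4) 3 ↔ DiffLeTwo k (wideBand k r) (s 4) (s 3) by
        rw [s3], hs.two 4 (by omega) 3 (by omega)]
      intro j₁ h₁ j₂ h₂ j₃ h₃
      unfold wideBand circBand
      omega
    · intro a ha b hb hane hbne hda hdb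
      obtain ⟨u, hu, rfl⟩ := hs.surj a ha
      obtain ⟨v, hv, rfl⟩ := hs.surj b hb
      rw [hs.one 4 (by omega) _ (by assumption)] at hda hdb
      have h34 := not_wideBand_diffLeOne_four_three h4 hk
      have hu5 := eq_or_succ_of_wideBand_diffLeOne h4 hk (by omega) (by omega) hu hda
      have hv5 := eq_or_succ_of_wideBand_diffLeOne h4 hk (by omega) (by omega) hv hdb
      have : u ≠ 3 := by rintro rfl; exact h34 hda
      have : v ≠ 3 := by rintro rfl; exact h34 hdb
      have : u ≠ 4 := by rintro rfl; exact hane rfl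
      have : v ≠ 4 := by rintro rfl; exact hbne rfl
      rw [show u = v by omega]
  have high : ∀ i, 3 ≤ i → i < k → s i = i := by
    intro i h3 hik
    rcases Nat.lt_or_ge i 4 with h | h
    · rw [show i = 3 by omega]; exact s3
    · refine hs.eq_of_path (a := 4) (b := k - 1) (by omega) s4
        (fun i h h' => wideBand_diffLeOne_succ h4 hk h (by omega))
        (fun i i' h h' hi' hd => ?_) i h (by omega)
      have := eq_or_succ_of_wideBand_diffLeOne h4 hk h (by omega) hi' hd
      have : i = 4 → i' ≠ 3 := by rintro rfl rfl; exact not_wideBand_diffLeOne_four_three h4 hk hd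
      omega
  have low : ∀ i < 3, s i < 3 := by
    intro i hi
    by_contra hc
    have := hs.inj _ (hs.lt i (by omega)) i (by omega) (high _ (by omega) (hs.lt i (by omega)))
    omega
  have n03 : ¬ DiffLeTwo k (wideBand k r) 0 3 := fun h => by
    have := h 0 (by omega) 2 (by omega) r (by omega)
    unfold wideBand circBand at this
    omega
  have d13 : DiffLeTwo k (wideBand k r) 1 3 := by
    intro j₁ h₁ j₂ h₂ j₃ h₃
    unfold wideBand circBand
    omega
  have d23 : DiffLeTwo k (wideBand k r) 2 3 := by
    intro j₁ h₁ j₂ h₂ j₃ h₃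
    unfold wideBand circBand
    omega
  have d1k : DiffLeTwo k (wideBand k r) 1 (k - 1) := by
    intro j₁ h₁ j₂ h₂ j₃ h₃
    unfold wideBand circBand
    omega
  have n2k : ¬ DiffLeTwo k (wideBand k r) 2 (k - 1) := fun h => by
    have := h (r - 1) (by omega) r (by omega) (r + 1) (by omega)
    unfold wideBand circBand at this
    omega
  have t1 := hs.two 1 (by omega) 3 (by omega)
  have t2 := hs.two 2 (by omega) 3 (by omega)
  have t1k := hs.two 1 (by omega) (k - 1) (by omega)
  rw [s3] at t1 t2
  rw [high (k - 1) (by omega) (by omega)] at t1k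
  have l0 := low 0 (by omega)
  have l1 := low 1 (by omega)
  have l2 := low 2 (by omega)
  have a1 : s 1 ≠ 0 := fun h => by rw [h] at t1; exact n03 (t1.2 d13)
  have a2 : s 2 ≠ 0 := fun h => by rw [h] at t2; exact n03 (t2.2 d23)
  have a3 : s 1 ≠ 2 := fun h => by rw [h] at t1k; exact n2k (t1k.2 d1k)
  have i01 : s 0 ≠ s 1 := fun h => by have := hs.inj 0 (by omega) 1 (by omega) h; omega
  have i02 : s 0 ≠ s 2 := fun h => by have := hs.inj 0 (by omega) 2 (by omega) h; omega
  have i12 : s 1 ≠ s 2 := fun h => by have := hs.inj 1 (by omega) 2 (by omega) h; omega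
  intro i hik
  rcases (show i = 0 ∨ i = 1 ∨ i = 2 ∨ 3 ≤ i by omega) with rfl | rfl | rfl | h
  · omega
  · omega
  · omega
  · exact high i h hik

lemma narrowBand_diffLeOne_succ {i : ℕ} (hi : i ≠ 3) (hi' : i ≠ 4) (hik : i + 1 < k) (hk : 9 ≤ k) :
    DiffLeOne k (narrowBand k) i (i + 1) ∧ DiffLeOne k (narrowBand k) (i + 1) i := by
  constructor <;> intro j₁ h₁ j₂ h₂ <;> unfold narrowBand circBand <;> omega

lemma eq_or_succ_of_narrowBand_diffLeOne (hk : 9 ≤ k) {i i' : ℕ} (hik : i + 1 < k) (hi'k : i' < k)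
    (h : DiffLeOne k (narrowBand k) i i') :
    i' = i ∨ (i' = i + 1 ∧ i ≠ 3 ∧ i ≠ 4) ∨ (i' + 1 = i ∧ i ≠ 4 ∧ i ≠ 5) := by
  by_contra hc
  by_cases h0 : i = 0
  · subst h0
    have h₁ := h 1 (by omega) 2 (by omega)
    have h₂ := h 1 (by omega) 5 (by omega)
    have h₃ := h 2 (by omega) 5 (by omega)
    unfold narrowBand circBand at h₁ h₂ h₃
    omega
  by_cases h0 : i = 4
  · subst h0
    have h₁ := h 0 (by omega) 4 (by omega)
    have h₂ := h 0 (by omega) 6 (by omega)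
    have h₃ := h 4 (by omega) 6 (by omega)
    unfold narrowBand circBand at h₁ h₂ h₃
    omega
  by_cases h0 : i + 2 = k
  · have h₁ := h i (by omega) (i + 1) (by omega)
    have h₂ := h i (by omega) 0 (by omega)
    have h₃ := h (i + 1) (by omega) 0 (by omega)
    unfold narrowBand circBand at h₁ h₂ h₃
    omega
  · have h₁ := h i (by omega) (i + 1) (by omega)
    have h₂ := h i (by omega) (i + 2) (by omega)
    have h₃ := h (i + 1) (by omega) (i + 2) (by omega)
    unfold narrowBand circBand at h₁ h₂ h₃
    omega

lemma narrowBand_diffLeTwo_four (hk : 9 ≤ k) {i : ℕ} (hi : i = 3 ∨ i = 5 ∨ i = k - 1) :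
    DiffLeTwo k (narrowBand k) i 4 := by
  intro j₁ h₁ j₂ h₂ j₃ h₃
  rcases hi with rfl | rfl | rfl <;> unfold narrowBand circBand <;> omega

lemma narrowBand_diffLeTwo_last_one (hk : 9 ≤ k) : DiffLeTwo k (narrowBand k) (k - 1) 1 := by
  intro j₁ h₁ j₂ h₂ j₃ h₃
  unfold narrowBand circBand
  omega

lemma eq_self_of_preservesDiff_narrowBand (hk : 9 ≤ k) {s : ℕ → ℕ}
    (hs : PreservesDiff k (narrowBand k) s) : ∀ i < k, s i = i := by
  have leaf : ∀ i < k, (∀ a < k, ∀ b < k, a ≠ i → b ≠ i → DiffLeOne k (narrowBand k) i a →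
      DiffLeOne k (narrowBand k) i b → a = b) → i = 0 ∨ i = 3 ∨ i = 4 ∨ i = 5 ∨ i = k - 1 := by
    intro i hik h
    by_contra hc
    have h₁ := (narrowBand_diffLeOne_succ (i := i - 1) (by omega) (by omega) (by omega) hk).2
    rw [show i - 1 + 1 = i by omega] at h₁
    have := h (i - 1) (by omega) (i + 1) (by omega) (by omega) (by omega) h₁
      (narrowBand_diffLeOne_succ (by omega) (by omega) (by omega) hk).1
    omega
  have leaf_image : ∀ i < k, i = 0 ∨ i = 5 →
      s i = 0 ∨ s i = 3 ∨ s i = 4 ∨ s i = 5 ∨ s i = k - 1 := by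
    intro i hik hi
    refine leaf _ (hs.lt i hik) fun a ha b hb hane hbne hda hdb => ?_
    obtain ⟨u, hu, rfl⟩ := hs.surj a ha
    obtain ⟨v, hv, rfl⟩ := hs.surj b hb
    rw [hs.one i hik _ (by assumption)] at hda hdb
    have : u ≠ i := by rintro rfl; exact hane rfl
    have : v ≠ i := by rintro rfl; exact hbne rfl
    have := eq_or_succ_of_narrowBand_diffLeOne hk (by omega) hu hda
    have := eq_or_succ_of_narrowBand_diffLeOne hk (by omega) hv hdb
    rw [show u = v by omega]
  have s4 : s 4 = 4 := by
    by_contra hc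
    have hlt := hs.lt 4 (by omega)
    obtain ⟨i', hi', hne, hd⟩ : ∃ i' < k, i' ≠ s 4 ∧ DiffLeOne k (narrowBand k) (s 4) i' := by
      by_cases h : s 4 = 3 ∨ s 4 = k - 1
      · refine ⟨s 4 - 1, by omega, by omega, ?_⟩
        have := (narrowBand_diffLeOne_succ (i := s 4 - 1) (by omega) (by omega) (by omega) hk).2
        rwa [show s 4 - 1 + 1 = s 4 by omega] at this
      · exact ⟨s 4 + 1, by omega, by omega,
          (narrowBand_diffLeOne_succ (by omega) (by omega) (by omega) hk).1⟩
    obtain ⟨u, hu, rfl⟩ := hs.surj i' hi'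
    rw [hs.one 4 (by omega) u hu] at hd
    have := eq_or_succ_of_narrowBand_diffLeOne hk (by omega) hu hd
    exact hne (by rw [show u = 4 by omega])
  have s0 : s 0 = 0 := by
    have hne : s 0 ≠ 4 := fun h => by
      have := hs.inj 0 (by omega) 4 (by omega) (h.trans s4.symm)
      omega
    have h04 : ¬ DiffLeTwo k (narrowBand k) (s 0) 4 := by
      have := hs.two 0 (by omega) 4 (by omega)
      rw [s4] at this
      rw [this]
      intro h
      have := h 1 (by omega) 2 (by omega) 5 (by omega)
      unfold narrowBand circBand at this
      omega
    have := leaf_image 0 (by omega) (by omega)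
    have := mt (narrowBand_diffLeTwo_four hk (i := s 0)) h04
    omega
  have low : ∀ i, 0 ≤ i → i ≤ 3 → s i = i :=
    hs.eq_of_path (by omega) s0
      (fun i _ h => (narrowBand_diffLeOne_succ (by omega) (by omega) (by omega) hk).1)
      (fun i i' _ h hi' hd => by
        have := eq_or_succ_of_narrowBand_diffLeOne hk (by omega) hi' hd
        omega)
  have s5 : s 5 = 5 := by
    have hne : ∀ i ≤ 4, s 5 ≠ i := fun i hi h => by
      have hi' : s i = i := by
        rcases Nat.eq_or_lt_of_le hi with rfl | h'
        · exact s4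
        · exact low i (by omega) (by omega)
      have := hs.inj 5 (by omega) i (by omega) (h.trans hi'.symm)
      omega
    have h51 : ¬ DiffLeTwo k (narrowBand k) (s 5) 1 := by
      have := hs.two 5 (by omega) 1 (by omega)
      rw [low 1 (by omega) (by omega)] at this
      rw [this]
      intro h
      have := h 5 (by omega) 6 (by omega) 7 (by omega)
      unfold narrowBand circBand at this
      omega
    have h : s 5 ≠ k - 1 := fun h => h51 (h ▸ narrowBand_diffLeTwo_last_one hk)
    have := leaf_image 5 (by omega) (by omega)
    have := hne 0 (by omega)
    have := hne 3 (by omega)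
    have := hne 4 (by omega)
    omega
  have high : ∀ i, 5 ≤ i → i ≤ k - 1 → s i = i :=
    hs.eq_of_path (by omega) s5
      (fun i h h' => (narrowBand_diffLeOne_succ (by omega) (by omega) (by omega) hk).1)
      (fun i i' h h' hi' hd => by
        have := eq_or_succ_of_narrowBand_diffLeOne hk (by omega) hi' hd
        omega)
  intro i hik
  rcases (show i ≤ 3 ∨ i = 4 ∨ 5 ≤ i by omega) with h | rfl | h
  · exact low i (by omega) h
  · exact s4
  · exact high i h (by omega)

end

/-- Only the trivial pair of row and column permutations fixes `B`. -/
def IsAsymmetric {k : ℕ} (B : Fin k → Fin k → ℕ) : Prop :=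
  ∀ σ τ : Equiv.Perm (Fin k), (∀ i j, B (σ i) (τ j) = B i j) → σ = 1 ∧ τ = 1

lemma isAsymmetric_of_rows {k : ℕ} {B : Fin k → Fin k → ℕ}
    (hrow : ∀ σ τ : Equiv.Perm (Fin k), (∀ i j, B (σ i) (τ j) = B i j) → σ = 1)
    (hcol : ∀ j j', (∀ i, B i j = B i j') → j = j') : IsAsymmetric B := by
  intro σ τ h
  have hσ := hrow σ τ h
  subst hσ
  exact ⟨rfl, Equiv.ext fun j => hcol _ _ fun i => h i j⟩

lemma stabCard_eq_one_of_isAsymmetric {k : ℕ} {N : Fin k → Fin k → ℕ} (h : IsAsymmetric N) :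
    stabCard N = 1 := by
  rw [stabCard, Nat.card_eq_one_iff_unique]
  refine ⟨⟨fun p q => Subtype.ext ?_⟩, ⟨⟨1, fun _ _ => rfl⟩⟩⟩
  have hp := h _ _ p.2
  have hq := h _ _ q.2
  exact Prod.ext (hp.1.trans hq.1.symm) (hp.2.trans hq.2.symm)

lemma stabCard_pos {k : ℕ} (N : Fin k → Fin k → ℕ) : 0 < stabCard N :=
  have : Nonempty {p : Equiv.Perm (Fin k) × Equiv.Perm (Fin k) //
    ∀ i j, N (p.1 i) (p.2 j) = N i j} := ⟨⟨1, fun _ _ => rfl⟩⟩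
  Nat.card_pos

lemma apply_iff_symm {k : ℕ} {A : ℕ → ℕ → Prop} {σ τ : Equiv.Perm (Fin k)}
    (h : ∀ i j : Fin k, A (σ i) (τ j) ↔ A i j) (i j : Fin k) :
    A (σ i) j ↔ A i (τ.symm j) := by
  rw [← h i, Equiv.apply_symm_apply]

lemma diffLeOne_perm {k : ℕ} {A : ℕ → ℕ → Prop} {σ τ : Equiv.Perm (Fin k)}
    (h : ∀ i j : Fin k, A (σ i) (τ j) ↔ A i j) (i i' : Fin k) :
    DiffLeOne k A (σ i) (σ i') ↔ DiffLeOne k A i i' := by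
  constructor
  · intro hd j₁ h₁ j₂ h₂
    have := hd _ (τ ⟨j₁, h₁⟩).2 _ (τ ⟨j₂, h₂⟩).2
    simpa only [h, ← Fin.ext_iff, τ.injective.eq_iff, Fin.mk.injEq] using this
  · intro hd j₁ h₁ j₂ h₂
    have := hd _ (τ.symm ⟨j₁, h₁⟩).2 _ (τ.symm ⟨j₂, h₂⟩).2
    simp only [← apply_iff_symm h, ← Fin.ext_iff, τ.symm.injective.eq_iff, Fin.mk.injEq] at this
    exact this

lemma diffLeTwo_perm {k : ℕ} {A : ℕ → ℕ → Prop} {σ τ : Equiv.Perm (Fin k)}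
    (h : ∀ i j : Fin k, A (σ i) (τ j) ↔ A i j) (i i' : Fin k) :
    DiffLeTwo k A (σ i) (σ i') ↔ DiffLeTwo k A i i' := by
  constructor
  · intro hd j₁ h₁ j₂ h₂ j₃ h₃
    have := hd _ (τ ⟨j₁, h₁⟩).2 _ (τ ⟨j₂, h₂⟩).2 _ (τ ⟨j₃, h₃⟩).2
    simpa only [h, ← Fin.ext_iff, τ.injective.eq_iff, Fin.mk.injEq] using this
  · intro hd j₁ h₁ j₂ h₂ j₃ h₃
    have := hd _ (τ.symm ⟨j₁, h₁⟩).2 _ (τ.symm ⟨j₂, h₂⟩).2 _ (τ.symm ⟨j₃, h₃⟩).2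
    simp only [← apply_iff_symm h, ← Fin.ext_iff, τ.symm.injective.eq_iff, Fin.mk.injEq] at this
    exact this

lemma preservesDiff_of_perm {k : ℕ} {A : ℕ → ℕ → Prop} {σ τ : Equiv.Perm (Fin k)}
    (h : ∀ i j : Fin k, A (σ i) (τ j) ↔ A i j) :
    PreservesDiff k A fun i => if hi : i < k then (σ ⟨i, hi⟩ : ℕ) else i where
  lt i hi := by simp [hi]
  inj i hi i' hi' := by simp [hi, hi', ← Fin.ext_iff]
  surj i hi := ⟨(σ⁻¹ ⟨i, hi⟩ : Fin k), Fin.isLt _, by simp⟩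
  one i hi i' hi' := by simpa [hi, hi'] using diffLeOne_perm h ⟨i, hi⟩ ⟨i', hi'⟩
  two i hi i' hi' := by simpa [hi, hi'] using diffLeTwo_perm h ⟨i, hi⟩ ⟨i', hi'⟩

open Classical in
/-- The `0`-`1` matrix of a relation. -/
noncomputable def relMatrix (k : ℕ) (A : ℕ → ℕ → Prop) (i j : Fin k) : ℕ :=
  if A i j then 1 else 0

lemma relMatrix_le_one (k : ℕ) (A : ℕ → ℕ → Prop) (i j : Fin k) : relMatrix k A i j ≤ 1 := by
  unfold relMatrix
  split_ifs <;> omega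

lemma relMatrix_eq_iff {k : ℕ} {A : ℕ → ℕ → Prop} {i j i' j' : Fin k} :
    relMatrix k A i j = relMatrix k A i' j' ↔ (A i j ↔ A i' j') := by
  unfold relMatrix
  split_ifs <;> simp_all

lemma relMatrix_isAsymmetric {k : ℕ} {A : ℕ → ℕ → Prop}
    (hA : ∀ s, PreservesDiff k A s → ∀ i < k, s i = i)
    (hcol : ∀ j < k, ∀ j' < k, j < j' → ∃ i < k, ¬ (A i j ↔ A i j')) :
    IsAsymmetric (relMatrix k A) := by
  refine isAsymmetric_of_rows (fun σ τ h => Equiv.ext fun i => Fin.ext ?_) fun j j' h => ?_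
  · simp only [relMatrix_eq_iff] at h
    simpa using hA _ (preservesDiff_of_perm h) i i.2
  · simp only [relMatrix_eq_iff] at h
    by_contra hne
    rcases lt_or_gt_of_ne hne with hlt | hlt
    · obtain ⟨i, hi, hn⟩ := hcol j j.2 j' j'.2 hlt
      exact hn (h ⟨i, hi⟩)
    · obtain ⟨i, hi, hn⟩ := hcol j' j'.2 j j.2 hlt
      exact hn (h ⟨i, hi⟩).symm

lemma exists_row_ne_wideBand {k r : ℕ} (h4 : 4 ≤ r) (hk : 2 * r ≤ k) {j j' : ℕ} (hj' : j' < k)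
    (hlt : j < j') : ∃ i < k, ¬ (wideBand k r i j ↔ wideBand k r i j') := by
  rcases (show (j = 2 ∧ j' = r) ∨ (j' ≤ j + r ∧ ¬ (j = 2 ∧ j' = r)) ∨ j + r < j' by omega)
    with h | h | h
  · refine ⟨4, by omega, ?_⟩
    unfold wideBand circBand
    omega
  · refine ⟨j + 1, by omega, ?_⟩
    unfold wideBand circBand
    omega
  · refine ⟨j, by omega, ?_⟩
    unfold wideBand circBand
    omega

lemma exists_row_ne_narrowBand {k : ℕ} (hk : 9 ≤ k) {j j' : ℕ} (hj' : j' < k)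
    (hlt : j < j') : ∃ i < k, ¬ (narrowBand k i j ↔ narrowBand k i j') := by
  rcases (show (j = 3 ∧ j' = 5) ∨ (j = 0 ∧ j' = 6) ∨ (j = 0 ∧ 4 ≤ j' ∧ j' ≠ 6 ∧ j' ≠ 5) ∨
    (j = 0 ∧ j' = 5) ∨
    (j' ≤ j + 3 ∧ ¬ (j = 3 ∧ j' = 5)) ∨ (j ≠ 0 ∧ j + 3 < j') by omega)
    with h | h | h | h | h | h
  · refine ⟨5, by omega, ?_⟩
    unfold narrowBand circBand
    omega
  · refine ⟨5, by omega, ?_⟩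
    unfold narrowBand circBand
    omega
  · refine ⟨j' - 2, by omega, ?_⟩
    unfold narrowBand circBand
    omega
  · refine ⟨0, by omega, ?_⟩
    unfold narrowBand circBand
    omega
  · refine ⟨j + 1, by omega, ?_⟩
    unfold narrowBand circBand
    omega
  · refine ⟨j, by omega, ?_⟩
    unfold narrowBand circBand
    omega

lemma circBand_iff {k r : ℕ} (i j : Fin k) :
    circBand k r i j ↔ ((j - i : Fin k) : ℕ) < r := by
  rw [Fin.val_sub]
  have := i.2
  have := j.2
  unfold circBand
  rcases Nat.lt_or_ge (j : ℕ) i with h | h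
  · rw [Nat.mod_eq_of_lt (by omega)]
    omega
  · rw [show k - (i : ℕ) + j = (j - i) + k by omega, Nat.add_mod_right,
      Nat.mod_eq_of_lt (by omega)]
    omega

lemma isInterMatrix_circBand {k r : ℕ} (hr : r ≤ k) :
    IsInterMatrix k r (relMatrix k (circBand k r)) := by
  rcases Nat.eq_zero_or_pos k with rfl | hk
  · exact ⟨fun i => i.elim0, fun i => i.elim0⟩
  have : NeZero k := ⟨hk.ne'⟩
  have key : ∑ j : Fin k, (if (j : ℕ) < r then 1 else 0) = r := by
    rw [Fin.sum_univ_eq_sum_range (fun j => if j < r then 1 else 0) k, ← Finset.sum_filter,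
      Finset.sum_const, smul_eq_mul, mul_one]
    rw [show (Finset.range k).filter (· < r) = Finset.range r by ext; simp; omega,
      Finset.card_range]
  constructor
  · intro i
    simp only [relMatrix, circBand_iff]
    rw [← Equiv.sum_comp (Equiv.subRight i)] at key
    exact (Finset.sum_congr rfl fun _ _ => by simp).trans key
  · intro j
    simp only [relMatrix, circBand_iff]
    rw [← Equiv.sum_comp (Equiv.subLeft j)] at key
    exact (Finset.sum_congr rfl fun _ _ => by simp).trans key

/-- A switch in rows `a`, `b` and columns `x`, `y` does not change the line sums. -/
lemma IsInterMatrix.of_switch {k l : ℕ} {B C : Fin k → Fin k → ℕ} (hC : IsInterMatrix k l C)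
    (a b x y : Fin k)
    (h : ∀ i j, B i j + (if i = a ∧ j = x then 1 else 0) + (if i = b ∧ j = y then 1 else 0) =
      C i j + (if i = a ∧ j = y then 1 else 0) + (if i = b ∧ j = x then 1 else 0)) :
    IsInterMatrix k l B := by
  constructor
  · intro i
    have := Finset.sum_congr (rfl : (Finset.univ : Finset (Fin k)) = _) fun j _ => h i j
    simp only [Finset.sum_add_distrib, hC.1 i, ite_and] at this
    by_cases ha : i = a <;> by_cases hb : i = b <;> simp [ha, hb] at this ⊢ <;> omega
  · intro j
    have := Finset.sum_congr (rfl : (Finset.univ : Finset (Fin k)) = _) fun i _ => h i j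
    simp only [Finset.sum_add_distrib, hC.2 j, ite_and] at this
    simp at this
    omega

lemma isInterMatrix_wideBand {k r : ℕ} (h4 : 4 ≤ r) (hk : 2 * r ≤ k) :
    IsInterMatrix k r (relMatrix k (wideBand k r)) := by
  refine (isInterMatrix_circBand (by omega)).of_switch ⟨0, by omega⟩ ⟨3, by omega⟩ ⟨1, by omega⟩
    ⟨r, by omega⟩ fun ⟨i, hi⟩ ⟨j, hj⟩ => ?_
  simp only [relMatrix, Fin.mk.injEq]
  unfold wideBand circBand
  split_ifs <;> omega

lemma isInterMatrix_narrowBand {k : ℕ} (hk : 9 ≤ k) :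
    IsInterMatrix k 3 (relMatrix k (narrowBand k)) := by
  refine (isInterMatrix_circBand (by omega)).of_switch ⟨0, by omega⟩ ⟨4, by omega⟩ ⟨0, by omega⟩
    ⟨5, by omega⟩ fun ⟨i, hi⟩ ⟨j, hj⟩ => ?_
  simp only [relMatrix, Fin.mk.injEq]
  unfold narrowBand circBand
  split_ifs <;> omega

/-- Iterated sums of squared row overlaps, an invariant of row and column permutations. -/
def overlapWeight {k : ℕ} (B : Fin k → Fin k → ℕ) : ℕ → Fin k → ℕ
  | 0, _ => 1
  | t + 1, i => ∑ i', (∑ j, B i j * B i' j) ^ 2 * overlapWeight B t i'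

lemma overlapWeight_perm {k : ℕ} {B : Fin k → Fin k → ℕ} {σ τ : Equiv.Perm (Fin k)}
    (h : ∀ i j, B (σ i) (τ j) = B i j) (t : ℕ) (i : Fin k) :
    overlapWeight B t (σ i) = overlapWeight B t i := by
  induction t generalizing i with
  | zero => rfl
  | succ t ih =>
    rw [overlapWeight, overlapWeight, ← Equiv.sum_comp σ]
    refine Finset.sum_congr rfl fun i' _ => ?_
    rw [ih, ← Equiv.sum_comp τ]
    simp only [h]

/-- An asymmetric cubic `8 × 8` matrix. -/
def cubicEight : Fin 8 → Fin 8 → ℕ :=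
  ![![1, 1, 1, 0, 0, 0, 0, 0], ![0, 1, 1, 1, 0, 0, 0, 0], ![0, 0, 1, 1, 1, 0, 0, 0],
    ![0, 0, 0, 1, 1, 1, 0, 0], ![1, 0, 0, 0, 0, 1, 1, 0], ![0, 1, 0, 0, 0, 1, 0, 1],
    ![0, 0, 0, 0, 1, 0, 1, 1], ![1, 0, 0, 0, 0, 0, 1, 1]]

lemma overlapWeight_cubicEight :
    overlapWeight cubicEight 3 = ![5303, 6253, 6313, 5249, 5145, 4043, 5211, 5959] := by
  have h1 : overlapWeight cubicEight 1 = ![17, 19, 19, 17, 17, 15, 17, 19] := by decide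
  have h2 : overlapWeight cubicEight 2 = ![299, 347, 349, 297, 295, 241, 297, 339] := by
    funext i
    rw [overlapWeight, h1]
    revert i
    decide
  funext i
  rw [overlapWeight, h2]
  revert i
  decide

lemma isAsymmetric_cubicEight : IsAsymmetric cubicEight := by
  refine isAsymmetric_of_rows (fun σ τ h => Equiv.ext fun i => ?_) (by decide)
  have hinj : ∀ a b : Fin 8, overlapWeight cubicEight 3 a = overlapWeight cubicEight 3 b →
      a = b := by
    rw [overlapWeight_cubicEight]
    decide
  exact hinj _ _ (overlapWeight_perm h 3 i)

/-- There is an asymmetric `0`-`1` matrix with all line sums equal to `r`. -/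
def HasAsymmetric (k r : ℕ) : Prop :=
  ∃ B : Fin k → Fin k → ℕ, (∀ i j, B i j ≤ 1) ∧ IsInterMatrix k r B ∧ IsAsymmetric B

lemma HasAsymmetric.compl {k r : ℕ} (h : HasAsymmetric k r) : HasAsymmetric k (k - r) := by
  obtain ⟨B, hB, hI, hA⟩ := h
  have sum_compl : ∀ f : Fin k → ℕ, (∀ i, f i ≤ 1) → ∑ i, f i = r → ∑ i, (1 - f i) = k - r := by
    intro f hf hs
    have : ∑ i, ((1 - f i) + f i) = k := by
      rw [Finset.sum_congr rfl fun i _ => Nat.sub_add_cancel (hf i)]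
      simp
    rw [Finset.sum_add_distrib] at this
    omega
  refine ⟨fun i j => 1 - B i j, fun i j => Nat.sub_le _ _,
    ⟨fun i => sum_compl _ (hB i) (hI.1 i), fun j => sum_compl _ (hB · j) (hI.2 j)⟩,
    fun σ τ h => hA σ τ fun i j => ?_⟩
  have : 1 - B (σ i) (τ j) = 1 - B i j := h i j
  have := hB i j
  have := hB (σ i) (τ j)
  omega

lemma hasAsymmetric_of_two_mul_le {k r : ℕ} (hk : 8 ≤ k) (hr : 3 ≤ r) (hrk : 2 * r ≤ k) :
    HasAsymmetric k r := by
  rcases (show 4 ≤ r ∨ (r = 3 ∧ 9 ≤ k) ∨ (r = 3 ∧ k = 8) by omega) with h | ⟨rfl, h⟩ | ⟨rfl, rfl⟩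
  · exact ⟨_, relMatrix_le_one k _, isInterMatrix_wideBand h hrk,
      relMatrix_isAsymmetric (fun s hs => eq_self_of_preservesDiff_wideBand h hrk hs)
        fun j _ j' hj' hlt => exists_row_ne_wideBand h hrk hj' hlt⟩
  · exact ⟨_, relMatrix_le_one k _, isInterMatrix_narrowBand h,
      relMatrix_isAsymmetric (fun s hs => eq_self_of_preservesDiff_narrowBand h hs)
        fun j _ j' hj' hlt => exists_row_ne_narrowBand h hj' hlt⟩
  · exact ⟨cubicEight, by decide, by unfold IsInterMatrix; decide, isAsymmetric_cubicEight⟩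

lemma hasAsymmetric {k r : ℕ} (hk : 8 ≤ k) (hr : 3 ≤ r) (hrk : r ≤ k - 3) :
    HasAsymmetric k r := by
  rcases Nat.lt_or_ge k (2 * r) with h | h
  · have := (hasAsymmetric_of_two_mul_le hk (r := k - r) (by omega) (by omega)).compl
    rwa [show k - (k - r) = r by omega] at this
  · exact hasAsymmetric_of_two_mul_le hk hr h

lemma factorial_mul_pow_lt {q n : ℕ} (hq : n ≠ q) (hq' : n ≠ q + 1) :
    q.factorial * (q + 1) ^ n < n.factorial * (q + 1) ^ q := by
  rcases Nat.lt_or_ge n q with h | h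
  · obtain ⟨d, rfl⟩ := Nat.exists_eq_add_of_le h.le
    have hd : d ≠ 0 := by omega
    have : (n + d).factorial < n.factorial * (n + d + 1) ^ d := by
      rw [← Nat.factorial_mul_ascFactorial]
      have h1 := Nat.ascFactorial_le_pow_add n d
      have h2 : (n + d) ^ d < (n + d + 1) ^ d := Nat.pow_lt_pow_left (by omega) hd
      exact Nat.mul_lt_mul_of_pos_left (h1.trans_lt h2) (Nat.factorial_pos n)
    calc (n + d).factorial * (n + d + 1) ^ n
        < n.factorial * (n + d + 1) ^ d * (n + d + 1) ^ n :=
          Nat.mul_lt_mul_of_pos_right this (by positivity)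
      _ = _ := by ring
  · obtain ⟨d, rfl⟩ := Nat.exists_eq_add_of_le (show q + 1 ≤ n by omega)
    have h1 := Nat.factorial_mul_pow_le_factorial (m := q + 1) (n := d)
    have h2 : (q + 1) ^ d < (q + 1 + 1) ^ d := Nat.pow_lt_pow_left (by omega) (by omega)
    have h3 : (q + 1).factorial * (q + 1) ^ d < (q + 1 + d).factorial :=
      (Nat.mul_lt_mul_of_pos_left h2 (Nat.factorial_pos _)).trans_le h1
    calc q.factorial * (q + 1) ^ (q + 1 + d)
        = (q + 1).factorial * (q + 1) ^ d * (q + 1) ^ q := by rw [Nat.factorial_succ]; ring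
      _ < _ := Nat.mul_lt_mul_of_pos_right h3 (by positivity)

lemma factorial_mul_pow_eq {q n : ℕ} (h : n = q ∨ n = q + 1) :
    q.factorial * (q + 1) ^ n = n.factorial * (q + 1) ^ q := by
  rcases h with rfl | rfl
  · rfl
  · rw [Nat.factorial_succ]
    ring

lemma factorial_mul_pow_le (q n : ℕ) :
    q.factorial * (q + 1) ^ n ≤ n.factorial * (q + 1) ^ q := by
  by_cases h : n = q ∨ n = q + 1
  · exact (factorial_mul_pow_eq h).le
  · rw [not_or] at h
    exact (factorial_mul_pow_lt h.1 h.2).le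

section
variable {k q r : ℕ} {N : Fin k → Fin k → ℕ}

lemma IsInterMatrix.sum_prod {l : ℕ} (hN : IsInterMatrix k l N) :
    ∑ p : Fin k × Fin k, N p.1 p.2 = k * l := by
  rw [Fintype.sum_prod_type]
  simp [hN.1]

lemma prod_factorial_mul_pow (hr : r ≤ k) (hN : IsInterMatrix k (q * k + r) N) :
    ((q + 1).factorial ^ (r * k) * q.factorial ^ (k ^ 2 - r * k)) * ((q + 1) ^ q) ^ k ^ 2 =
      ∏ p : Fin k × Fin k, q.factorial * (q + 1) ^ N p.1 p.2 := by
  rw [Finset.prod_mul_distrib, Finset.prod_pow_eq_pow_sum, hN.sum_prod, Finset.prod_const,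
    Finset.card_univ, Fintype.card_prod, Fintype.card_fin, Nat.factorial_succ, mul_pow]
  have hle : r * k ≤ k ^ 2 := by nlinarith
  have h : q.factorial ^ (k * k) = q.factorial ^ (r * k) * q.factorial ^ (k ^ 2 - r * k) := by
    rw [← pow_add, Nat.add_sub_cancel' hle, sq]
  rw [h]
  ring

lemma prod_factorial_mul_pow' :
    (∏ i, ∏ j, (N i j).factorial) * ((q + 1) ^ q) ^ k ^ 2 =
      ∏ p : Fin k × Fin k, (N p.1 p.2).factorial * (q + 1) ^ q := by
  rw [Finset.prod_mul_distrib, Fintype.prod_prod_type, Finset.prod_const,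
    Finset.card_univ, Fintype.card_prod, Fintype.card_fin, sq]

lemma le_prod_factorial (hr : r ≤ k) (hN : IsInterMatrix k (q * k + r) N) :
    (q + 1).factorial ^ (r * k) * q.factorial ^ (k ^ 2 - r * k) ≤
      ∏ i, ∏ j, (N i j).factorial := by
  refine Nat.le_of_mul_le_mul_right (c := ((q + 1) ^ q) ^ k ^ 2) ?_ (by positivity)
  rw [prod_factorial_mul_pow hr hN, prod_factorial_mul_pow']
  exact Finset.prod_le_prod' fun p _ => factorial_mul_pow_le q _

lemma prod_factorial_eq_iff (hr : r ≤ k) (hN : IsInterMatrix k (q * k + r) N) :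
    ∏ i, ∏ j, (N i j).factorial = (q + 1).factorial ^ (r * k) * q.factorial ^ (k ^ 2 - r * k) ↔
      ∀ i j, N i j = q ∨ N i j = q + 1 := by
  have hpos : 0 < ((q + 1) ^ q) ^ k ^ 2 := by positivity
  rw [← Nat.mul_left_inj hpos.ne', prod_factorial_mul_pow hr hN, prod_factorial_mul_pow']
  constructor
  · intro h
    by_contra! hc
    obtain ⟨i, j, hij⟩ := hc
    refine (Finset.prod_lt_prod (fun p _ => ?_)
      (fun p _ => factorial_mul_pow_le q (N p.1 p.2))
      ⟨(i, j), Finset.mem_univ _, factorial_mul_pow_lt hij.1 hij.2⟩).ne' h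
    positivity
  · intro h
    exact Finset.prod_congr rfl fun p _ => (factorial_mul_pow_eq (h p.1 p.2)).symm

lemma entries_eq_of_mem (hN : IsInterMatrix k (q * k + r) N)
    (h : ∀ i j, N i j = q ∨ N i j = q + 1) :
    entries N = Multiset.replicate (r * k) (q + 1) + Multiset.replicate (k ^ 2 - r * k) q := by
  set S : Finset (Fin k × Fin k) := Finset.univ.filter fun p => q + 1 = N p.1 p.2 with hS
  set T : Finset (Fin k × Fin k) := Finset.univ.filter fun p => q = N p.1 p.2 with hT
  have hsum : ∑ p : Fin k × Fin k, N p.1 p.2 = q * k ^ 2 + S.card := by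
    have : ∀ p : Fin k × Fin k, N p.1 p.2 = q + if q + 1 = N p.1 p.2 then 1 else 0 := by
      intro p
      have := h p.1 p.2
      split_ifs <;> omega
    rw [Finset.sum_congr rfl fun p _ => this p, Finset.sum_add_distrib, Finset.sum_boole]
    simp [hS, sq, mul_comm]
  have hScard : S.card = r * k := by
    rw [hN.sum_prod] at hsum
    nlinarith
  have hcard : S.card + T.card = k ^ 2 := by
    have hdisj : T = Finset.univ.filter fun p => ¬ (q + 1 = N p.1 p.2) := by
      ext p
      have := h p.1 p.2
      simp only [hT, Finset.mem_filter, Finset.mem_univ, true_and]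
      omega
    rw [hdisj, hS, Finset.card_filter_add_card_filter_not]
    simp [sq]
  have hTcard : T.card = k ^ 2 - r * k := by omega
  ext a
  rw [entries, Multiset.count_map, Multiset.count_add, Multiset.count_replicate,
    Multiset.count_replicate, ← Finset.filter_val, Finset.card_val]
  by_cases h1 : a = q + 1
  · subst h1
    simp [← hScard, hS]
  by_cases h2 : a = q
  · subst h2
    simp [← hTcard, hT]
  · rw [if_neg (Ne.symm h1), if_neg (Ne.symm h2), Finset.card_eq_zero,
      Finset.filter_eq_empty_iff]
    intro p _
    have := h p.1 p.2
    omega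

end

lemma exists_autCard_eq {k q r : ℕ} (hk : 8 ≤ k) (hr3 : 3 ≤ r) (hrk : r ≤ k - 3) :
    ∃ N : Fin k → Fin k → ℕ, IsInterMatrix k (q * k + r) N ∧
      autCard N = (q + 1).factorial ^ (r * k) * q.factorial ^ (k ^ 2 - r * k) := by
  obtain ⟨B, hB, hI, hA⟩ := hasAsymmetric hk hr3 hrk
  have hN : IsInterMatrix k (q * k + r) fun i j => q + B i j := by
    constructor
    · intro i
      rw [Finset.sum_add_distrib, hI.1 i]
      simp [mul_comm]
    · intro j
      rw [Finset.sum_add_distrib, hI.2 j]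
      simp [mul_comm]
  refine ⟨_, hN, ?_⟩
  rw [autCard, stabCard_eq_one_of_isAsymmetric, one_mul, prod_factorial_eq_iff (by omega) hN]
  · intro i j
    have := hB i j
    omega
  · exact fun σ τ h => hA σ τ fun i j => Nat.add_left_cancel (h i j)

/-- χ(k,l) for l = qk + r with 3 ≤ r ≤ k−3, k ≥ 8, together with the structure of the
minimising matrices. -/
theorem chi_middle (k l q r : ℕ) (hk : 8 ≤ k) (hl : 2 ≤ l)
    (hlqr : l = q * k + r) (hr3 : 3 ≤ r) (hrk : r ≤ k - 3) :
    IsLeast {m | ∃ N : Fin k → Fin k → ℕ, IsInterMatrix k l N ∧ m = autCard N}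
      ((q + 1).factorial ^ (r * k) * q.factorial ^ (k ^ 2 - r * k)) ∧
    ∀ N : Fin k → Fin k → ℕ, IsInterMatrix k l N →
      autCard N = (q + 1).factorial ^ (r * k) * q.factorial ^ (k ^ 2 - r * k) →
      stabCard N = 1 ∧
        entries N = Multiset.replicate (r * k) (q + 1) + Multiset.replicate (k ^ 2 - r * k) q := by
  subst hlqr
  have hr : r ≤ k := by omega
  refine ⟨⟨?_, ?_⟩, ?_⟩
  · obtain ⟨N, hN, h⟩ := exists_autCard_eq (q := q) hk hr3 hrk
    exact ⟨N, hN, h.symm⟩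
  · rintro m ⟨N, hN, rfl⟩
    exact (le_prod_factorial hr hN).trans (Nat.le_mul_of_pos_left _ (stabCard_pos N))
  · intro N hN h
    have hle := le_prod_factorial hr hN
    have hpos : 0 < ∏ i, ∏ j, (N i j).factorial :=
      Finset.prod_pos fun i _ => Finset.prod_pos fun j _ => Nat.factorial_pos _
    have hone : stabCard N = 1 := by
      refine le_antisymm (Nat.le_of_mul_le_mul_right ?_ hpos) (stabCard_pos N)
      rw [one_mul]
      exact h.trans_le hle
    rw [autCard, hone, one_mul, prod_factorial_eq_iff hr hN] at h
    exact ⟨hone, entries_eq_of_mem hN h⟩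
end
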